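/- arXiv:0810.2737 — 2 statements merged into one kernel-verified Lean document; each statement's English description precedes it below -/
import Mathlib

section
/- Let F be an algebraically closed field of characteristic 0 and let g be the simple Lie algebra of type D4 over F (equivalently, a finite-dimensional simple Lie algebra over F with dim g = 28). Then there exists a grading of g by the group (ℤ/2ℤ)^3 such that dim g_α = 4 for every nonzero α ∈ (ℤ/2ℤ)^3 (so necessarily g_0 = 0), and any two such gradings of g are equivalent. -/
open Module

/-- A grading of the Lie algebra `L` over `F` by the additive group `A`:
a direct sum decomposition into subspaces compatible with the bracket. -/
def IsLieGrading (F : Type*) {A L : Type*} [Field F] [AddCommGroup A] [DecidableEq A]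
    [LieRing L] [LieAlgebra F L] (gr : A → Submodule F L) : Prop :=
  DirectSum.IsInternal gr ∧
    ∀ a b : A, ∀ x ∈ gr a, ∀ y ∈ gr b, ⁅x, y⁆ ∈ gr (a + b)

/-- Two gradings of `L` are equivalent if some automorphism of `L` maps each nonzero
homogeneous component of the first grading onto a homogeneous component of the second. -/
def GradingsEquiv (F : Type*) {A B L : Type*} [Field F] [AddCommGroup A] [AddCommGroup B]
    [LieRing L] [LieAlgebra F L] (gr : A → Submodule F L) (gr' : B → Submodule F L) : Prop :=
  ∃ φ : L ≃ₗ⁅F⁆ L, ∀ a : A, gr a ≠ ⊥ →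
    ∃ b : B, (gr a).map φ.toLinearEquiv.toLinearMap = gr' b

namespace CartanSearch

/-- The pairs of absolute values `(|A i j|, |A j i|)` of off-diagonal entries of Cartan matrices. -/
def pairs : List (ℕ × ℕ) := [(0, 0), (1, 1), (1, 2), (2, 1), (1, 3), (3, 1)]

def tuples : ℕ → List (List (ℕ × ℕ))
  | 0 => [[]]
  | n + 1 => pairs.flatMap fun p => (tuples n).map (p :: ·)

def extend (A : List (List ℕ)) (ps : List (ℕ × ℕ)) : List (List ℕ) :=
  (0 :: ps.map Prod.fst) :: List.zipWith (fun p c => p.2 :: c) ps A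

def linked (ps : List (ℕ × ℕ)) : Bool := ps.any fun p => !p.1.beq 0

def dot : List ℕ → List ℕ → ℕ
  | x :: v, y :: w => x * y + dot v w
  | _, _ => 0

def eqv : List ℕ → List ℕ → Bool
  | x :: v, y :: w => x.beq y && eqv v w
  | [], [] => true
  | _, _ => false

/-- The `j`-th simple reflection, where `c` is the `j`-th column of the matrix. -/
def reflect (c v : List ℕ) (j : ℕ) : List ℕ := v.modify j (dot v c - ·)

def units : ℕ → List (List ℕ)
  | 0 => []
  | n + 1 => (1 :: List.replicate n 0) :: (units n).map (0 :: ·)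

/-- `forceNat n k = k n`, but the kernel normalises `n` before substituting it. -/
def forceNat {α : Type} (n : ℕ) (k : ℕ → α) : α := Nat.casesOn n (k 0) fun m => k m.succ

def force {α : Type} : List ℕ → (List ℕ → α) → α
  | [], k => k []
  | x :: v, k => forceNat x fun y => force v fun w => k (y :: w)

def insertNew (l : List (List ℕ)) (w : List ℕ) : List (List ℕ) :=
  if l.any (eqv w) then l else w :: l

def raise (A l : List (List ℕ)) (v : List ℕ) : List (List ℕ) :=
  if Nat.ble 13 l.length then l else
    A.zipIdx.foldl (fun l p => if Nat.blt (2 * v.getD p.2 0) (dot v p.1) then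
      force (reflect p.1 v p.2) (insertNew l) else l) l

/-- Positive roots, as coefficient vectors, of the root system with Cartan matrix `2 - A`;
the search is cut off once there are at least 13. -/
def grow (A : List (List ℕ)) : ℕ → List (List ℕ)
  | 0 => units A.length
  | n + 1 => (grow A n).foldl (raise A) (grow A n)

/-- `l` contains the simple roots and all simple reflections of its elements, up to sign. -/
def closed (A l : List (List ℕ)) : Bool :=
  ((units A.length).all fun u => l.any (eqv u)) &&
  l.all fun v => A.zipIdx.all fun p => eqv v ((units A.length).getD p.2 []) ||
    (Nat.ble (v.getD p.2 0) (dot v p.1) && l.any (eqv (reflect p.1 v p.2)))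

def small (A : List (List ℕ)) : Bool := Nat.ble (grow A 4).length 12

def extensions₁ : List (List (List ℕ)) := ((tuples 1).filter linked).map (extend [[0]])

def extensions₂ : List (List (List ℕ)) :=
  extensions₁.flatMap fun A => ((tuples 2).filter linked).map (extend A)

def extensions₃ (S : List (List (List ℕ))) : List (List (List ℕ)) :=
  S.flatMap fun A => ((tuples 2).filter fun ps =>
      !linked ps || S.contains (extend (A.tail.map List.tail) ps)).flatMap
    fun ps => ((pairs.map (· :: ps)).filter linked).map (extend A)

/-- The matrices `2 - C` for `C` a Cartan matrix of finite type and rank three. -/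
def matrices₃ : List (List (List ℕ)) :=
  [[[0, 0, 1], [0, 0, 1], [1, 1, 0]], [[0, 0, 1], [0, 0, 1], [2, 1, 0]],
   [[0, 0, 2], [0, 0, 1], [1, 1, 0]], [[0, 1, 0], [1, 0, 1], [0, 1, 0]],
   [[0, 1, 0], [2, 0, 1], [0, 1, 0]], [[0, 2, 0], [1, 0, 1], [0, 1, 0]],
   [[0, 0, 1], [0, 0, 1], [1, 2, 0]], [[0, 1, 0], [1, 0, 1], [0, 2, 0]],
   [[0, 0, 1], [0, 0, 2], [1, 1, 0]], [[0, 1, 0], [1, 0, 2], [0, 1, 0]]]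

set_option maxRecDepth 10000

lemma closed_of_mem_extensions₁ :
    extensions₁.all (fun A => closed A (grow A 4) && Nat.blt (grow A 4).length 13) = true := by
  decide +kernel

lemma mem_matrices₃_of_small :
    extensions₂.all (fun A => !small A || matrices₃.contains A) = true := by
  decide +kernel

lemma closed_of_mem_matrices₃ : matrices₃.all (fun A => closed A (grow A 4)) = true := by
  decide +kernel

lemma small_extensions₃ :
    (extensions₃ matrices₃).all (fun A => !small A || Nat.ble 10 (grow A 4).length &&
      (closed A (grow A 4) && !(grow A 4).length.beq 12 ||
      [[[0, 0, 0, 1], [0, 0, 0, 1], [0, 0, 0, 1], [1, 1, 1, 0]],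
       [[0, 0, 1, 0], [0, 0, 1, 0], [1, 1, 0, 1], [0, 0, 1, 0]]].contains A)) = true := by
  decide +kernel

lemma forceNat_eq {α : Type} (n : ℕ) (k : ℕ → α) : forceNat n k = k n := by
  cases n <;> rfl

lemma force_eq {α : Type} (v : List ℕ) (k : List ℕ → α) : force v k = k v := by
  induction v generalizing k with
  | nil => rfl
  | cons x v ih => simp [force, forceNat_eq, ih]

lemma eqv_iff (v w : List ℕ) : eqv v w = true ↔ v = w := by
  induction v generalizing w with
  | nil => cases w <;> simp [eqv]
  | cons x v ih => cases w <;> simp [eqv, ih]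

lemma any_eqv_iff (l : List (List ℕ)) (w : List ℕ) : l.any (eqv w) = true ↔ w ∈ l := by
  simp [List.any_eq_true, eqv_iff]

lemma mem_tuples {n : ℕ} {l : List (ℕ × ℕ)} (hl : l.length = n) (h : ∀ p ∈ l, p ∈ pairs) :
    l ∈ tuples n := by
  induction n generalizing l with
  | zero => simp_all [tuples]
  | succ n ih =>
    obtain _ | ⟨p, l⟩ := l
    · simp at hl
    · simp only [tuples, List.mem_flatMap, List.mem_map]
      exact ⟨p, h p (by simp), l, ih (by simpa using hl) fun q hq => h q (by simp [hq]), rfl⟩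

lemma length_units (n : ℕ) : (units n).length = n := by
  induction n with
  | zero => rfl
  | succ n ih => simp [units, ih]

lemma nodup_units (n : ℕ) : (units n).Nodup := by
  induction n with
  | zero => simp [units]
  | succ n ih =>
    simp only [units, List.nodup_cons, List.mem_map]
    refine ⟨by simp, ih.map fun v w h => by simpa using h⟩

end CartanSearch

namespace RootPairing.Base

open CartanSearch

set_option linter.unusedSectionVars false

variable {ι K M N : Type*} [Field K] [CharZero K] [AddCommGroup M] [Module K M] [AddCommGroup N]
  [Module K N] {P : RootPairing ι K M N} [Finite ι] [P.IsRootSystem] [P.IsCrystallographic]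
  [P.IsReduced] (b : P.Base)

open Classical in
/-- The absolute value of an off-diagonal entry of the Cartan matrix, zero on the diagonal. -/
noncomputable def absEntry (i j : b.support) : ℕ :=
  if i = j then 0 else (-b.cartanMatrix i j).toNat

/-- The columns of the matrix `absEntry` restricted to a list of simple roots. -/
noncomputable def absMatrix (s : List b.support) : List (List ℕ) :=
  s.map fun j => s.map fun i => b.absEntry i j

/-- The linear combination of the simple roots in `s` with coefficients `v`. -/
noncomputable def combination : List b.support → List ℕ → M
  | i :: s, x :: v => x • P.root i + combination s v
  | _, _ => 0

/-- `l` is a list of coefficient vectors of distinct positive roots in the span of `s`. -/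
structure IsRootList (s : List b.support) (l : List (List ℕ)) : Prop where
  nodup : l.Nodup
  length_eq : ∀ v ∈ l, v.length = s.length
  exists_root : ∀ v ∈ l, ∃ k, P.root k = b.combination s v

@[simp] lemma absEntry_self (i : b.support) : b.absEntry i i = 0 := by simp [absEntry]

lemma absEntry_of_ne {i j : b.support} (h : i ≠ j) :
    (b.absEntry i j : ℤ) = -b.cartanMatrix i j := by
  have := b.cartanMatrix_le_zero_of_ne i j h
  simp [absEntry, h, this]

lemma absEntry_mem_pairs {i j : b.support} (h : i ≠ j) :
    (b.absEntry i j, b.absEntry j i) ∈ pairs := by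
  have hij : (i : ι) ≠ j := Subtype.coe_ne_coe.2 h
  have h1 := b.absEntry_of_ne h
  have h2 := b.absEntry_of_ne h.symm
  have h3 := b.cartanMatrix_le_zero_of_ne i j h
  have h4 := P.pairingIn_pairingIn_mem_set_of_isCrystal_of_isRed' (i := i) (j := j)
    (P.root.injective.ne hij) (b.root_ne_neg_of_ne i.2 j.2 hij)
  change (b.cartanMatrix i j, b.cartanMatrix j i) ∈ _ at h4
  generalize b.cartanMatrix i j = x at *
  generalize b.cartanMatrix j i = y at *
  generalize b.absEntry i j = z at *
  generalize b.absEntry j i = w at *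
  simp only [Set.mem_insert_iff, Set.mem_singleton_iff, Prod.mk.injEq] at h4
  simp only [pairs, List.mem_cons, Prod.mk.injEq, List.not_mem_nil, or_false]
  omega

lemma absMatrix_cons (j : b.support) (s : List b.support) :
    b.absMatrix (j :: s) =
      extend (b.absMatrix s) (s.map fun i => (b.absEntry i j, b.absEntry j i)) := by
  simp [absMatrix, extend, List.zipWith_map, List.zipWith_self, Function.comp_def]

lemma combination_replicate (s : List b.support) (n : ℕ) :
    b.combination s (List.replicate n 0) = 0 := by
  induction s generalizing n with
  | nil => cases n <;> simp [combination]
  | cons i s ih => cases n <;> simp [combination, List.replicate_succ, ih]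

lemma combination_units (s : List b.support) (k : ℕ) (hk : k < s.length) :
    b.combination s ((units s.length).getD k []) = P.root s[k] := by
  induction s generalizing k with
  | nil => simp at hk
  | cons i s ih =>
    cases k with
    | zero => simp [units, combination, combination_replicate]
    | succ k =>
      have hk' : k < s.length := by simpa using hk
      have := ih k hk'
      have h2 : k < (units s.length).length := by rwa [length_units]
      simp_all [units, combination]

lemma combination_modify (s : List b.support) (v : List ℕ) (f : ℕ → ℕ) (k : ℕ)
    (hk : k < s.length) (hv : v.length = s.length) :
    b.combination s (v.modify k f) =
      b.combination s v + ((f (v.getD k 0) : ℤ) - v.getD k 0) • P.root s[k] := by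
  induction s generalizing v k with
  | nil => simp at hk
  | cons i s ih =>
    obtain _ | ⟨x, v⟩ := v
    · simp at hv
    cases k with
    | zero => simp [combination, sub_smul]; abel
    | succ k =>
      simp only [List.modify_succ_cons, combination, List.getD_cons_succ, List.getElem_cons_succ]
      rw [ih v k (by simpa using hk) (by simpa using hv)]
      abel

lemma pairing_eq_neg_absEntry {i j : b.support} (h : i ≠ j) :
    P.pairing i j = -(b.absEntry i j : K) := by
  have h1 : ((b.absEntry i j : ℤ) : K) = ((-P.pairingIn ℤ i j : ℤ) : K) :=
    congrArg _ (b.absEntry_of_ne h)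
  have h2 := P.algebraMap_pairingIn ℤ i j
  push_cast at h1
  rw [h1, neg_neg, ← h2]
  simp

lemma coroot'_combination_of_notMem (s : List b.support) (v : List ℕ) {j : b.support}
    (hj : j ∉ s) :
    P.coroot' j (b.combination s v) = -(dot v (s.map fun i => b.absEntry i j) : K) := by
  induction s generalizing v with
  | nil => cases v <;> simp [combination, dot]
  | cons i s ih =>
    obtain _ | ⟨x, v⟩ := v
    · simp [combination, dot]
    · simp only [List.mem_cons, not_or] at hj
      simp only [combination, map_add, map_nsmul, root_coroot'_eq_pairing, ih v hj.2,
        b.pairing_eq_neg_absEntry (Ne.symm hj.1), List.map_cons, dot, nsmul_eq_mul]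
      push_cast; ring

lemma coroot'_combination {s : List b.support} (hs : s.Nodup) (v : List ℕ) (k : ℕ)
    (hk : k < s.length) (hv : v.length = s.length) :
    P.coroot' s[k] (b.combination s v) =
      2 * (v.getD k 0 : K) - dot v (s.map fun i => b.absEntry i s[k]) := by
  induction s generalizing v k with
  | nil => simp at hk
  | cons i s ih =>
    obtain _ | ⟨x, v⟩ := v
    · simp at hv
    rw [List.nodup_cons] at hs
    cases k with
    | zero =>
      simp only [List.getElem_cons_zero, combination, map_add, map_nsmul,
        root_coroot'_eq_pairing, b.coroot'_combination_of_notMem s v hs.1, List.map_cons, dot,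
        nsmul_eq_mul, List.getD_cons_zero, absEntry_self, P.pairing_same]
      push_cast; ring
    | succ k =>
      have hk' : k < s.length := by simpa using hk
      have hne : i ≠ s[k] := fun h => hs.1 (h ▸ List.getElem_mem _)
      simp only [List.getElem_cons_succ, combination, map_add, map_nsmul,
        root_coroot'_eq_pairing, ih hs.2 v k hk' (by simpa using hv),
        b.pairing_eq_neg_absEntry hne, List.map_cons, dot, nsmul_eq_mul, List.getD_cons_succ]
      push_cast; ring

lemma repr_combination_of_notMem (s : List b.support) (v : List ℕ) {j : b.support}
    (hj : j ∉ s) : b.toWeightBasis.repr (b.combination s v) j = 0 := by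
  induction s generalizing v with
  | nil => cases v <;> simp [combination]
  | cons i s ih =>
    obtain _ | ⟨x, v⟩ := v
    · simp [combination]
    · simp only [List.mem_cons, not_or] at hj
      simp [combination, ih v hj.2, Ne.symm hj.1]

lemma repr_combination {s : List b.support} (hs : s.Nodup) (v : List ℕ) (k : ℕ)
    (hk : k < s.length) (hv : v.length = s.length) :
    b.toWeightBasis.repr (b.combination s v) s[k] = v.getD k 0 := by
  induction s generalizing v k with
  | nil => simp at hk
  | cons i s ih =>
    obtain _ | ⟨x, v⟩ := v
    · simp at hv
    rw [List.nodup_cons] at hs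
    cases k with
    | zero => simp [combination, b.repr_combination_of_notMem s v hs.1]
    | succ k =>
      have hk' : k < s.length := by simpa using hk
      have hne : i ≠ s[k] := fun h => hs.1 (h ▸ List.getElem_mem _)
      have := ih hs.2 v k hk' (by simpa using hv)
      simp_all [combination]

lemma reflection_combination {s : List b.support} (hs : s.Nodup) (v : List ℕ) (k : ℕ)
    (hk : k < s.length) (hv : v.length = s.length)
    (h : v.getD k 0 ≤ dot v (s.map fun i => b.absEntry i s[k])) :
    P.reflection s[k] (b.combination s v) =
      b.combination s (reflect (s.map fun i => b.absEntry i s[k]) v k) := by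
  rw [reflect, b.combination_modify s v _ k hk hv, P.reflection_apply,
    b.coroot'_combination hs v k hk hv, sub_eq_add_neg, ← neg_smul]
  congr 1
  rw [← Int.cast_smul_eq_zsmul K]
  congr 1
  push_cast [h]
  ring

lemma combination_injOn {s : List b.support} (hs : s.Nodup) {v w : List ℕ}
    (hv : v.length = s.length) (hw : w.length = s.length)
    (h : b.combination s v = b.combination s w) : v = w := by
  refine List.ext_getElem (hv.trans hw.symm) fun k hk hk' => ?_
  have h1 := b.repr_combination hs v k (hv ▸ hk) hv
  rw [h, b.repr_combination hs w k (hv ▸ hk) hw] at h1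
  simpa [List.getD_eq_getElem, hk, hk', eq_comm] using h1

lemma combination_ne_neg {s : List b.support} (hs : s.Nodup) {v w : List ℕ}
    (hv : v.length = s.length) (hw : w.length = s.length) {k : ι}
    (hk : P.root k = b.combination s v) : b.combination s v ≠ -b.combination s w := by
  intro h
  have h0 : v = List.replicate s.length 0 := by
    refine List.eq_replicate_iff.2 ⟨hv, fun x hx => ?_⟩
    obtain ⟨n, hn, rfl⟩ := List.getElem_of_mem hx
    have h1 := b.repr_combination hs v n (hv ▸ hn) hv
    rw [h, map_neg, Finsupp.neg_apply, b.repr_combination hs w n (hv ▸ hn) hw] at h1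
    have h2 : (w.getD n 0 + v.getD n 0 : ℕ) = (0 : K) := by push_cast; rw [← h1]; ring
    have h3 : w.getD n 0 + v.getD n 0 = 0 := by exact_mod_cast h2
    simpa [List.getD_eq_getElem, hn] using (Nat.add_eq_zero_iff.1 h3).2
  rw [h0, combination_replicate] at hk
  exact P.ne_zero k hk

end RootPairing.Base

namespace RootPairing.Base

open CartanSearch

set_option linter.unusedSectionVars false

variable {ι K M N : Type*} [Field K] [CharZero K] [AddCommGroup M] [Module K M] [AddCommGroup N]
  [Module K N] {P : RootPairing ι K M N} [Finite ι] [P.IsRootSystem] [P.IsCrystallographic]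
  [P.IsReduced] {b : P.Base}

namespace IsRootList

variable {s : List b.support} {l : List (List ℕ)}

lemma insertNew (h : b.IsRootList s l) {w : List ℕ} (hw : w.length = s.length)
    (hk : ∃ k, P.root k = b.combination s w) : b.IsRootList s (insertNew l w) := by
  unfold CartanSearch.insertNew
  split_ifs with hm
  · exact h
  · rw [any_eqv_iff] at hm
    exact ⟨List.nodup_cons.2 ⟨hm, h.nodup⟩, by simpa [hw] using h.length_eq,
      by simpa [hk] using h.exists_root⟩

lemma getElem_of_mem_zipIdx {p : List ℕ × ℕ} (hp : p ∈ (b.absMatrix s).zipIdx) :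
    ∃ h : p.2 < s.length, p.1 = s.map fun i => b.absEntry i s[p.2] := by
  obtain ⟨h1, h2⟩ := List.mem_zipIdx' hp
  have h3 : p.2 < s.length := by simpa [absMatrix] using h1
  exact ⟨h3, by simpa [absMatrix] using h2⟩

lemma exists_root_reflect (hs : s.Nodup) {v : List ℕ} (hv : v.length = s.length)
    (hk : ∃ k, P.root k = b.combination s v) {j : ℕ} (hj : j < s.length)
    (h : v.getD j 0 ≤ dot v (s.map fun i => b.absEntry i s[j])) :
    ∃ k, P.root k = b.combination s (reflect (s.map fun i => b.absEntry i s[j]) v j) := by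
  obtain ⟨k, hk⟩ := hk
  exact ⟨P.reflectionPerm s[j] k, by
    rw [P.root_reflectionPerm, hk, b.reflection_combination hs v j hj hv h]⟩

lemma raise (h : b.IsRootList s l) (hs : s.Nodup) {v : List ℕ} (hv : v.length = s.length)
    (hk : ∃ k, P.root k = b.combination s v) :
    b.IsRootList s (raise (b.absMatrix s) l v) := by
  unfold CartanSearch.raise
  split_ifs
  · exact h
  · refine List.foldlRecOn (motive := b.IsRootList s) _ _ h fun l' hl' p hp => ?_
    obtain ⟨hp2, hp1⟩ := getElem_of_mem_zipIdx hp
    split_ifs with hlt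
    · rw [force_eq]
      rw [Nat.blt_eq] at hlt
      rw [hp1] at hlt ⊢
      exact hl'.insertNew (by simpa [reflect] using hv)
        (exists_root_reflect hs hv hk hp2 (by omega))
    · exact hl'

lemma grow (hs : s.Nodup) (n : ℕ) : b.IsRootList s (grow (b.absMatrix s) n) := by
  induction n with
  | zero =>
    have hl : (b.absMatrix s).length = s.length := by simp [absMatrix]
    have key : ∀ v ∈ units s.length, ∃ k, ∃ hk : k < s.length, v = (units s.length).getD k [] := by
      intro v hv
      obtain ⟨k, hk, rfl⟩ := List.getElem_of_mem hv
      exact ⟨k, by rwa [length_units] at hk, by simp [hk]⟩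
    have len : ∀ n, ∀ v ∈ units n, v.length = n := by
      intro n
      induction n with
      | zero => simp [units]
      | succ n ih => simpa [units] using ih
    refine ⟨nodup_units _, ?_, ?_⟩ <;> simp only [CartanSearch.grow, hl]
    · exact len _
    · intro v hv
      obtain ⟨k, hk, rfl⟩ := key v hv
      exact ⟨s[k], (b.combination_units s k hk).symm⟩
  | succ n ih =>
    exact List.foldlRecOn (motive := b.IsRootList s) _ _ ih fun l' hl' v hv =>
      hl'.raise hs (ih.length_eq v hv) (ih.exists_root v hv)

lemma two_mul_length_le (h : b.IsRootList s l) (hs : s.Nodup) : 2 * l.length ≤ Nat.card ι := by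
  choose f hr using fun i : Fin l.length => h.exists_root _ (List.get_mem l i)
  let := P.indexNeg
  let g : Fin l.length ⊕ Fin l.length → ι :=
    Sum.elim f (fun i => -f i)
  have hl (i : Fin l.length) := h.length_eq _ (List.get_mem l i)
  have hinj (i j : Fin l.length) (hij : f i = f j) : i = j := by
    refine h.nodup.injective_get (b.combination_injOn hs (hl i) (hl j) ?_)
    rw [← hr, ← hr, hij]
  have hne (i j : Fin l.length) (hij : f i = -f j) : False := by
    refine b.combination_ne_neg hs (hl i) (hl j) (hr i) ?_
    rw [← hr, ← hr, hij]
    simp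
  have hg : Function.Injective g := by
    rintro (i | i) (j | j) hij <;> simp only [g, Sum.elim_inl, Sum.elim_inr] at hij
    · rw [hinj i j hij]
    · exact (hne i j hij).elim
    · exact (hne j i hij.symm).elim
    · rw [hinj i j (neg_injective hij)]
  have := Nat.card_le_card_of_injective g hg
  simpa [Nat.card_eq_fintype_card, two_mul] using this

lemma card_eq (h : b.IsRootList s l) (hs : s.Nodup) (hsurj : ∀ i, i ∈ s)
    (hc : closed (b.absMatrix s) l = true) : Nat.card ι = 2 * l.length := by
  refine le_antisymm ?_ (h.two_mul_length_le hs)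
  classical
  have hlen : (b.absMatrix s).length = s.length := by simp [absMatrix]
  simp only [closed, hlen, Bool.and_eq_true, List.all_eq_true, any_eqv_iff, Bool.or_eq_true,
    eqv_iff, Nat.ble_eq] at hc
  obtain ⟨hu, hc⟩ := hc
  have simple (j : b.support) : ∃ k, ∃ hk : k < s.length, s[k] = j := List.getElem_of_mem (hsurj j)
  have key (k : ι) : ∃ v ∈ l, P.root k = b.combination s v ∨ P.root k = -b.combination s v := by
    induction k using b.induction_reflect with
    | h₀ i hi =>
      obtain ⟨v, hv, hi⟩ := hi
      refine ⟨v, hv, ?_⟩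
      rw [P.root_reflectionPerm, P.reflection_apply_self, neg_inj, neg_eq_iff_eq_neg]
      exact hi.symm
    | h₁ i hi =>
      obtain ⟨k, hk, hik⟩ := simple ⟨i, hi⟩
      refine ⟨(units s.length).getD k [], hu _ ?_, .inl ?_⟩
      · have : k < (units s.length).length := by rwa [length_units]
        simp [this]
      · rw [b.combination_units s k hk, hik]
    | h₂ i j hi hj =>
      obtain ⟨k, hk, hjk⟩ := simple ⟨j, hj⟩
      obtain ⟨v, hv, hi⟩ := hi
      have hp : (s.map fun i => b.absEntry i s[k], k) ∈ (b.absMatrix s).zipIdx := by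
        rw [List.mem_zipIdx_iff_getElem?]
        simp [absMatrix, hk]
      have hr : P.root (P.reflectionPerm j i) = P.reflection s[k] (P.root i) := by
        rw [P.root_reflectionPerm, hjk]
      rcases hc v hv _ hp with hvk | ⟨h1, h2⟩
      · have hv' : b.combination s v = P.root s[k] := by rw [hvk, b.combination_units s k hk]
        refine ⟨v, hv, ?_⟩
        rw [hr]
        rcases hi with hi | hi <;> rw [hi, hv'] <;> simp
      · refine ⟨_, h2, ?_⟩
        rw [hr, ← b.reflection_combination hs v k hk (h.length_eq v hv) h1]
        rcases hi with hi | hi <;> rw [hi] <;> simp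
  let T : Finset M := (l.map (b.combination s)).toFinset ∪ (l.map (-b.combination s ·)).toFinset
  have hT : T.card ≤ 2 * l.length := by
    refine (Finset.card_union_le _ _).trans ?_
    have h1 := List.toFinset_card_le (l.map (b.combination s))
    have h2 := List.toFinset_card_le (l.map (-b.combination s ·))
    simp only [List.length_map] at h1 h2
    omega
  refine le_trans ?_ hT
  have hmem (k : ι) : P.root k ∈ T := by
    obtain ⟨v, hv, hk⟩ := key k
    simp only [T, Finset.mem_union, List.mem_toFinset, List.mem_map]
    exact hk.imp (fun hk => ⟨v, hv, hk.symm⟩) (fun hk => ⟨v, hv, hk.symm⟩)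
  have := Nat.card_le_card_of_injective (fun k => (⟨P.root k, hmem k⟩ : T))
    fun i j hij => P.root.injective (by simpa using hij)
  simpa using this

end IsRootList

end RootPairing.Base

/-- The Cartan matrix of type `D₄`, with the branch node listed first. -/
def cartanD4 : Matrix (Fin 4) (Fin 4) ℤ :=
  !![2, -1, -1, -1; -1, 2, 0, 0; -1, 0, 2, 0; -1, 0, 0, 2]

namespace RootPairing.Base

open CartanSearch Module

set_option linter.unusedSectionVars false

variable {ι K M N : Type*} [Field K] [CharZero K] [AddCommGroup M] [Module K M] [AddCommGroup N]
  [Module K N] {P : RootPairing ι K M N} [Finite ι] [P.IsRootSystem] [P.IsCrystallographic]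
  [P.IsReduced] (b : P.Base)

lemma cartanMatrix_eq_neg_absEntry {i j : b.support} (h : i ≠ j) :
    b.cartanMatrix i j = -b.absEntry i j := by
  have := b.absEntry_of_ne h
  omega

lemma exists_adjacent [P.IsIrreducible] {s : List b.support} (hs : s ≠ [])
    (hlt : s.length < b.support.card) : ∃ j ∉ s, ∃ i ∈ s, b.absEntry i j ≠ 0 := by
  by_contra! h
  obtain ⟨i, hi⟩ := List.exists_mem_of_ne_nil s hs
  have hall (j : b.support) : j ∈ s := by
    refine b.induction_on_cartanMatrix (· ∈ s) hi fun i j hi hij => ?_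
    by_contra hj
    have hne : i ≠ j := fun h => hj (h ▸ hi)
    refine hij (b.cartanMatrix_apply_eq_zero_iff_symm.1 ?_)
    rw [b.cartanMatrix_eq_neg_absEntry hne, h j hj i hi]
    simp
  classical
  have h1 : b.support.attach ⊆ s.toFinset := fun j _ => by simpa using hall j
  have h2 := (Finset.card_le_card h1).trans s.toFinset_card_le
  rw [Finset.card_attach] at h2
  omega

/-- The pairs of Cartan matrix entries of `j` against the nodes of `s`. -/
noncomputable def entryPairs (j : b.support) (s : List b.support) : List (ℕ × ℕ) :=
  s.map fun i => (b.absEntry i j, b.absEntry j i)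

lemma entryPairs_mem_tuples {j : b.support} {s : List b.support} (hj : j ∉ s) :
    b.entryPairs j s ∈ tuples s.length := by
  refine mem_tuples (by simp [entryPairs]) fun p hp => ?_
  obtain ⟨i, hi, rfl⟩ := List.mem_map.1 hp
  exact b.absEntry_mem_pairs fun h => hj (h ▸ hi)

lemma linked_entryPairs {j : b.support} {s : List b.support} :
    linked (b.entryPairs j s) = true ↔ ∃ i ∈ s, b.absEntry i j ≠ 0 := by
  simp [linked, entryPairs, ← Bool.not_eq_true]

lemma absMatrix_mem_extensions₁ {i j : b.support} (hij : j ≠ i) (h : b.absEntry i j ≠ 0) :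
    b.absMatrix [j, i] ∈ extensions₁ := by
  rw [absMatrix_cons]
  refine List.mem_map.2 ⟨b.entryPairs j [i], List.mem_filter.2
    ⟨b.entryPairs_mem_tuples (by simpa using hij), b.linked_entryPairs.2 ⟨i, by simp, h⟩⟩, ?_⟩
  simp [absMatrix, entryPairs]

lemma small_absMatrix {s : List b.support} (hs : s.Nodup) (hc : Nat.card ι < 26) :
    small (b.absMatrix s) = true := by
  have := (IsRootList.grow hs 4).two_mul_length_le hs
  rw [small, Nat.ble_eq]
  omega

lemma absMatrix_mem_matrices₃ {i j k : b.support} (hs : [k, j, i].Nodup)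
    (hc : Nat.card ι < 26) (h : b.absEntry i j ≠ 0) (hk : ∃ x ∈ [j, i], b.absEntry x k ≠ 0) :
    b.absMatrix [k, j, i] ∈ matrices₃ := by
  have h1 := List.all_eq_true.1 mem_matrices₃_of_small (b.absMatrix [k, j, i]) (by
    rw [absMatrix_cons]
    refine List.mem_flatMap.2 ⟨_, b.absMatrix_mem_extensions₁ (by simp_all) h,
      List.mem_map.2 ⟨b.entryPairs k [j, i], List.mem_filter.2 ⟨?_, b.linked_entryPairs.2 hk⟩, rfl⟩⟩
    exact b.entryPairs_mem_tuples (List.nodup_cons.1 hs).1)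
  simpa [b.small_absMatrix hs hc] using h1

lemma absMatrix_mem_extensions₃ {i j k l : b.support} (hs : [l, k, j, i].Nodup)
    (hc : Nat.card ι < 26) (h : b.absEntry i j ≠ 0) (hk : ∃ x ∈ [j, i], b.absEntry x k ≠ 0)
    (hl : ∃ x ∈ [k, j, i], b.absEntry x l ≠ 0) :
    b.absMatrix [l, k, j, i] ∈ extensions₃ matrices₃ := by
  have hs' := List.nodup_cons.1 hs
  rw [absMatrix_cons]
  refine List.mem_flatMap.2 ⟨_, b.absMatrix_mem_matrices₃ hs'.2 hc h hk, List.mem_flatMap.2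
    ⟨b.entryPairs l [j, i], List.mem_filter.2 ⟨b.entryPairs_mem_tuples (by simp_all), ?_⟩,
      List.mem_map.2 ⟨b.entryPairs l [k, j, i], List.mem_filter.2
        ⟨List.mem_map.2 ⟨(b.absEntry k l, b.absEntry l k), ?_, rfl⟩,
          b.linked_entryPairs.2 hl⟩, rfl⟩⟩⟩
  · rw [Bool.or_eq_true, Bool.not_eq_true', List.contains_iff_mem, or_iff_not_imp_left,
      Bool.not_eq_false, linked_entryPairs]
    intro hl'
    have := b.absMatrix_mem_matrices₃ (k := l) (by simp_all) hc h hl'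
    rw [absMatrix_cons] at this
    convert this using 2
    · simp [absMatrix]
    · rfl
  · exact b.absEntry_mem_pairs (by rintro rfl; simp_all)

lemma IsRootList.cons_cons {b : P.Base} {s : List b.support} {l : List (List ℕ)}
    (h : b.IsRootList s l) {j : b.support} (hj : j ∉ s) {k : ℕ} (hk : k < s.length)
    (hjk : b.absEntry s[k] j ≠ 0) :
    b.IsRootList (j :: s) ((1 :: List.replicate s.length 0) ::
      (1 :: (units s.length).getD k []) :: l.map (0 :: ·)) := by
  have hne : s[k] ≠ j := fun h => hj (h ▸ List.getElem_mem _)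
  have hne' : (s[k] : ι) ≠ j := Subtype.coe_ne_coe.2 hne
  obtain ⟨m, hm⟩ := P.root_add_root_mem_of_pairingIn_neg (i := s[k]) (j := j)
    (by change b.cartanMatrix _ _ < 0
        rw [b.cartanMatrix_eq_neg_absEntry hne]; omega)
    (b.root_ne_neg_of_ne s[k].2 j.2 hne')
  have hu := b.combination_units s k hk
  have hlen : ((units s.length).getD k []).length = s.length := by
    have len : ∀ n, ∀ v ∈ units n, v.length = n := by
      intro n
      induction n with
      | zero => simp [units]
      | succ n ih => simpa [units] using ih
    have h2 : k < (units s.length).length := by rwa [length_units]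
    exact len _ _ (by simp [h2])
  refine ⟨?_, ?_, ?_⟩
  · simp only [List.nodup_cons, List.mem_cons, List.cons.injEq, List.mem_map, true_and]
    refine ⟨?_, by simp, h.nodup.map fun v w h => by simpa using h⟩
    rintro (h0 | h0)
    · rw [← h0, combination_replicate] at hu
      exact P.ne_zero _ hu.symm
    · simp at h0
  · simp only [List.mem_cons, List.mem_map, List.length_cons]
    rintro v (rfl | rfl | ⟨w, hw, rfl⟩)
    · simp
    · simpa using hlen
    · simp [h.length_eq w hw]
  · simp only [List.mem_cons, List.mem_map]
    rintro v (rfl | rfl | ⟨w, hw, rfl⟩)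
    · exact ⟨j, by simp [combination, combination_replicate]⟩
    · exact ⟨m, by rw [hm, combination, hu]; simp [add_comm]⟩
    · simpa [combination] using h.exists_root w hw

lemma exists_equiv_of_absEntry (hr : b.support.card = 4) {c x y z : b.support}
    (hs : [c, x, y, z].Nodup)
    (h : b.absMatrix [c, x, y, z] = [[0, 1, 1, 1], [1, 0, 0, 0], [1, 0, 0, 0], [1, 0, 0, 0]]) :
    ∃ s : Fin 4 ≃ b.support, ∀ i j, b.cartanMatrix (s i) (s j) = cartanD4 i j := by
  have hf : Function.Injective ![c, x, y, z] := by
    simp only [List.nodup_cons, List.mem_cons, List.not_mem_nil, or_false, not_or] at hs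
    intro i j hij
    fin_cases i <;> fin_cases j <;> simp_all
  have hbij : Function.Bijective ![c, x, y, z] :=
    (Fintype.bijective_iff_injective_and_card _).2 ⟨hf, by simp [hr]⟩
  refine ⟨Equiv.ofBijective _ hbij, fun i j => ?_⟩
  by_cases hij : i = j
  · subst hij
    rw [b.cartanMatrix_apply_same]
    fin_cases i <;> rfl
  · simp only [Equiv.ofBijective_apply]
    rw [b.cartanMatrix_eq_neg_absEntry fun h => hij (hf h)]
    simp only [absMatrix, List.map_cons, List.map_nil, List.cons.injEq] at h
    fin_cases i <;> fin_cases j <;> simp_all [cartanD4]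

lemma exists_equiv_cartanD4 [P.IsIrreducible]
    (h : Nat.card ι + finrank K M = 28) :
    ∃ s : Fin 4 ≃ b.support, ∀ i j, b.cartanMatrix (s i) (s j) = cartanD4 i j := by
  classical
  have hr : finrank K M = b.support.card := by
    rw [finrank_eq_card_basis b.toWeightBasis, Fintype.card_coe]
  have hne : b.support.Nonempty := by
    have : Nontrivial M := IsIrreducible.nontrivial P
    rw [← Finset.card_pos, ← hr]
    have := Module.Finite.of_basis b.toWeightBasis
    exact finrank_pos
  obtain ⟨i, hi⟩ := hne
  lift i to b.support using hi
  have surj {s : List b.support} (hs : s.Nodup) (hl : s.length = b.support.card) (j) : j ∈ s := by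
    have h1 := Finset.eq_univ_of_card s.toFinset (by
      rw [List.toFinset_card_of_nodup hs, hl, Fintype.card_coe])
    have := Finset.mem_univ j
    rwa [← h1, List.mem_toFinset] at this
  have key {s : List b.support} (hs : s.Nodup) (hl : s.length = b.support.card)
      (hc : closed (b.absMatrix s) (CartanSearch.grow (b.absMatrix s) 4) = true) :=
    (IsRootList.grow hs 4).card_eq hs (surj hs hl) hc
  have hpos : 0 < b.support.card := Finset.card_pos.2 ⟨i, i.2⟩
  rcases eq_or_ne b.support.card 1 with h1 | h1
  · have := key (s := [i]) (by simp) (by simp [h1]) (by simp [absMatrix]; decide)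
    have h2 : (CartanSearch.grow (b.absMatrix [i]) 4).length = 1 := by simp [absMatrix]; decide
    omega
  obtain ⟨j, hj, x, hx, hij⟩ := b.exists_adjacent (s := [i]) (by simp) (by simp; omega)
  obtain rfl : x = i := by simpa using hx
  have hs₂ : [j, x].Nodup := by simpa using hj
  have hm₁ := List.all_eq_true.1 closed_of_mem_extensions₁ _
    (b.absMatrix_mem_extensions₁ (by simpa using hj) hij)
  rw [Bool.and_eq_true, Nat.blt_eq] at hm₁
  rcases eq_or_ne b.support.card 2 with h2 | h2
  · have := key hs₂ (by simp [h2]) hm₁.1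
    omega
  have hc : Nat.card ι < 26 := by omega
  obtain ⟨k, hk, hk'⟩ := b.exists_adjacent (s := [j, x]) (by simp) (by simp; omega)
  have hs₃ : [k, j, x].Nodup := List.nodup_cons.2 ⟨hk, hs₂⟩
  rcases eq_or_ne b.support.card 3 with h3 | h3
  · have := key hs₃ (by simp [h3]) (List.all_eq_true.1 closed_of_mem_matrices₃ _
      (b.absMatrix_mem_matrices₃ hs₃ hc hij hk'))
    omega
  obtain ⟨l, hl, hl'⟩ := b.exists_adjacent (s := [k, j, x]) (by simp) (by simp; omega)
  have hs₄ : [l, k, j, x].Nodup := List.nodup_cons.2 ⟨hl, hs₃⟩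
  have hm := List.all_eq_true.1 small_extensions₃ _
      (b.absMatrix_mem_extensions₃ hs₄ hc hij hk' hl')
  rw [b.small_absMatrix hs₄ hc, Bool.not_true, Bool.false_or, Bool.and_eq_true, Nat.ble_eq,
    Bool.or_eq_true, Bool.and_eq_true, Bool.not_eq_true', ← Bool.not_eq_true, Nat.beq_eq,
    List.contains_iff_mem] at hm
  obtain ⟨h10, hm⟩ := hm
  rcases eq_or_ne b.support.card 4 with h4 | h4
  · rcases hm with ⟨hm, h12⟩ | hm
    · have := key hs₄ (by simp [h4]) hm
      omega
    · simp only [List.mem_cons, List.not_mem_nil, or_false] at hm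
      rcases hm with hm | hm
      · refine b.exists_equiv_of_absEntry h4 (c := x) (x := j) (y := k) (z := l) ?_ ?_
        · simp only [List.nodup_cons, List.mem_cons, List.not_mem_nil, or_false, not_or] at hs₄ ⊢
          grind
        · simp_all [absMatrix]
      · refine b.exists_equiv_of_absEntry h4 (c := j) (x := x) (y := k) (z := l) ?_ ?_
        · simp only [List.nodup_cons, List.mem_cons, List.not_mem_nil, or_false, not_or] at hs₄ ⊢
          grind
        · simp_all [absMatrix]
  · obtain ⟨m, hm, y, hy, hym⟩ :=
      b.exists_adjacent (s := [l, k, j, x]) (by simp) (by simp; omega)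
    obtain ⟨n, hn, rfl⟩ := List.getElem_of_mem hy
    have := ((IsRootList.grow hs₄ 4).cons_cons hm hn hym).two_mul_length_le
      (List.nodup_cons.2 ⟨hm, hs₄⟩)
    simp only [List.length_cons, List.length_map] at this
    omega

end RootPairing.Base

namespace LieAlgebra.IsKilling

open LieModule Module

variable {K L : Type*} [Field K] [CharZero K] [LieRing L] [LieAlgebra K L]
  [IsKilling K L] [FiniteDimensional K L]
  {H : LieSubalgebra K L} [H.IsCartanSubalgebra] [IsTriangularizable K H L]

lemma finrank_add_card_root [Nontrivial L] :
    finrank K H + Nat.card H.root = finrank K L := by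
  classical
  have h_int : DirectSum.IsInternal fun χ : Weight K H L => (rootSpace H χ).toSubmodule :=
    DirectSum.isInternal_submodule_of_iSupIndep_of_iSup_eq_top
      (LieSubmodule.iSupIndep_toSubmodule.2 (iSupIndep_genWeightSpace' K H L))
      (by rw [← LieSubmodule.iSup_toSubmodule, iSup_genWeightSpace_eq_top',
        LieSubmodule.top_toSubmodule])
  have hsum : finrank K L = ∑ χ : Weight K H L, finrank K (rootSpace H χ) := by
    rw [← (LinearEquiv.ofBijective (DirectSum.coeLinearMap fun χ : Weight K H L =>
      (rootSpace H χ).toSubmodule) h_int).finrank_eq]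
    exact finrank_directSum K (fun χ : Weight K H L => (rootSpace H χ).toSubmodule)
  rw [hsum, ← Finset.sum_filter_add_sum_filter_not _ (fun χ : Weight K H L => χ.IsNonZero),
    add_comm]
  congr 1
  · rw [Finset.sum_congr rfl fun χ hχ => finrank_rootSpace_eq_one χ (Finset.mem_filter.1 hχ).2]
    rw [Finset.sum_const, smul_eq_mul, mul_one, Nat.card_eq_fintype_card, Fintype.card_coe]
  · have : Finset.univ.filter (fun χ : Weight K H L => ¬ χ.IsNonZero) = {0} := by
      ext χ
      simp only [Finset.mem_filter, Finset.mem_univ, true_and, Finset.mem_singleton, not_not]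
      exact Weight.isZero_iff_eq_zero
    rw [this, Finset.sum_singleton, FunLike.coe_zero, rootSpace_zero_eq]
    rfl

lemma lie_ne_zero_of_rootSpace_add_ne_bot {α β : Weight K H L} (hα : α.IsNonZero)
    (hβ : β.IsNonZero) (hαβ : rootSpace H (α + β : H → K) ≠ ⊥) {x y : L} (hx : x ∈ rootSpace H α)
    (hx₀ : x ≠ 0) (hy : y ∈ rootSpace H β) (hy₀ : y ≠ 0) : ⁅x, y⁆ ≠ 0 := by
  have hq : 1 ≤ chainTopCoeff α β := by
    have := ((rootSpace_zsmul_add_ne_bot_iff α β hα 1).1 (by simpa using hαβ)).1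
    exact_mod_cast this
  obtain ⟨n, hn⟩ := Nat.exists_eq_add_of_le' hq
  obtain ⟨m, hm, hm₀⟩ := (chainTop α β).exists_ne_zero
  obtain ⟨h, e, f, isSl2, he, hf⟩ := exists_isSl2Triple_of_weight_isNonZero hα
  obtain rfl := isSl2.h_eq_coroot hα he hf
  have prim : isSl2.HasPrimitiveVectorWith m (chainLength α β : K) :=
    have := lie_mem_genWeightSpace_of_mem_genWeightSpace he hm
    ⟨hm₀, (chainLength_smul _ _ hm).symm, by rwa [genWeightSpace_add_chainTop _ _ hα] at this⟩
  have hlen : n + 1 ≤ chainLength α β := hn ▸ chainTopCoeff_le_chainLength α β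
  obtain ⟨c, rfl⟩ : ∃ c : K, c • e = x := by
    simpa using (finrank_eq_one_iff_of_nonzero' (⟨e, he⟩ : rootSpace H α)
      (by simpa [Subtype.ext_iff] using isSl2.e_ne_zero)).mp (finrank_rootSpace_eq_one _ hα) ⟨x, hx⟩
  have hz := toEnd_pow_apply_mem hf hm (n + 1)
  rw [coe_chainTop', hn, smul_neg, neg_add_cancel_left] at hz
  have hz₀ := prim.pow_toEnd_f_ne_zero_of_eq_nat rfl hlen
  obtain ⟨d, hd⟩ : ∃ d : K, d • ((toEnd K L L f) ^ (n + 1)) m = y := by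
    simpa using (finrank_eq_one_iff_of_nonzero' (⟨_, hz⟩ : rootSpace H β)
      (by simpa [Subtype.ext_iff] using! hz₀)).mp (finrank_rootSpace_eq_one _ hβ) ⟨y, hy⟩
  subst hd
  rw [smul_lie, lie_smul, prim.lie_e_pow_succ_toEnd_f]
  refine smul_ne_zero (left_ne_zero_of_smul hx₀) (smul_ne_zero (left_ne_zero_of_smul hy₀)
    (smul_ne_zero ?_ (prim.pow_toEnd_f_ne_zero_of_eq_nat rfl (by omega))))
  refine mul_ne_zero (by exact_mod_cast n.succ_ne_zero) (sub_ne_zero.2 ?_)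
  exact_mod_cast (by omega : chainLength α β ≠ n)

end LieAlgebra.IsKilling

namespace LieAlgebra.IsKilling

open LieModule Module LieSubalgebra

variable {K L : Type*} [Field K] [CharZero K] [LieRing L] [LieAlgebra K L]
  [IsKilling K L] [FiniteDimensional K L]
  {H : LieSubalgebra K L} [H.IsCartanSubalgebra] [IsTriangularizable K H L]

lemma rootSpace_le_of_mem {α : Weight K H L} (hα : α.IsNonZero) {x : L} (hx : x ∈ rootSpace H α)
    (hx₀ : x ≠ 0) {S : Submodule K L} (hS : x ∈ S) : (rootSpace H α).toSubmodule ≤ S := by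
  intro y hy
  obtain ⟨c, rfl⟩ : ∃ c : K, c • x = y := by
    simpa using (finrank_eq_one_iff_of_nonzero' (⟨x, hx⟩ : rootSpace H α)
      (by simpa [Subtype.ext_iff] using hx₀)).mp (finrank_rootSpace_eq_one _ hα) ⟨y, hy⟩
  exact S.smul_mem c hS

lemma rootSpace_le_of_add {α β γ : Weight K H L} (hα : α.IsNonZero)
    (hβ : β.IsNonZero) (hγ : γ.IsNonZero) (h : (γ : H → K) = α + β) {S : LieSubalgebra K L}
    (h₁ : (rootSpace H α).toSubmodule ≤ S.toSubmodule)
    (h₂ : (rootSpace H β).toSubmodule ≤ S.toSubmodule) :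
    (rootSpace H γ).toSubmodule ≤ S.toSubmodule := by
  obtain ⟨x, hx, hx₀⟩ := α.exists_ne_zero
  obtain ⟨y, hy, hy₀⟩ := β.exists_ne_zero
  refine rootSpace_le_of_mem hγ (x := ⁅x, y⁆) ?_ ?_ (S.lie_mem (h₁ hx) (h₂ hy))
  · rw [h]; exact lie_mem_genWeightSpace_of_mem_genWeightSpace hx hy
  · exact lie_ne_zero_of_rootSpace_add_ne_bot hα hβ (h ▸ γ.genWeightSpace_ne_bot) hx hx₀ hy hy₀

lemma lieSubalgebra_eq_top (b : (rootSystem H).Base) {S : LieSubalgebra K L} (hH : H ≤ S)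
    (hS : ∀ i ∈ b.support, (rootSpace H i.1).toSubmodule ≤ S.toSubmodule ∧
      (rootSpace H (-i.1)).toSubmodule ≤ S.toSubmodule) : S = ⊤ := by
  have key (α : H.root) : (rootSpace H α.1).toSubmodule ≤ S.toSubmodule ∧
      (rootSpace H (-α.1)).toSubmodule ≤ S.toSubmodule := by
    induction α using b.induction_add with
    | h₀ i hi =>
      have h : ((rootSystem H).reflectionPerm i i).1 = -i.1 := by
        refine Weight.ext fun x => ?_
        have := (rootSystem H).root_reflectionPerm i i
        rw [RootPairing.reflection_apply_self] at this
        exact LinearMap.congr_fun this x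
      rw [h]
      exact ⟨hi.2, by simpa using hi.1⟩
    | h₁ i hi => exact hS i hi
    | h₂ i j k hk hi hj =>
      have h : (k.1 : H → K) = i.1 + j.1 := by
        ext x
        simpa using LinearMap.congr_fun hk x
      refine ⟨rootSpace_le_of_add (isNonZero_coe_root i) (isNonZero_coe_root j)
        (isNonZero_coe_root k) h hi.1 (hS j hj).1, ?_⟩
      refine rootSpace_le_of_add (α := -i.1) (β := -j.1) (γ := -k.1) (isNonZero_coe_root i).neg
        (isNonZero_coe_root j).neg (isNonZero_coe_root k).neg ?_ hi.2 (hS j hj).2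
      simp [h, add_comm]
  rw [← LieSubalgebra.toSubmodule_inj, LieSubalgebra.top_toSubmodule, eq_top_iff]
  rw [← LieSubmodule.top_toSubmodule (R := K) (L := H), ← iSup_genWeightSpace_eq_top' K H L,
    LieSubmodule.iSup_toSubmodule, iSup_le_iff]
  intro χ
  by_cases hχ : χ.IsZero
  · rw [hχ.eq]
    change (rootSpace H 0).toSubmodule ≤ _
    rw [rootSpace_zero_eq]
    exact hH
  · exact (key ⟨χ, by simpa [LieSubalgebra.root] using hχ⟩).1

lemma exists_basis (b : (rootSystem H).Base) {ι : Type*} [Finite ι] (s : ι ≃ b.support)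
    {A : Matrix ι ι ℤ} (hA : A.Nondegenerate) (hs : ∀ i j, b.cartanMatrix (s i) (s j) = A i j) :
    ∃ B : LieAlgebra.Basis ι H, B.A = A := by
  choose h e f ht he hf using fun i => exists_isSl2Triple_of_weight_isNonZero
    (isNonZero_coe_root (s i).1)
  have hh (i : ι) : h i = coroot (s i).1.1 :=
    (ht i).h_eq_coroot (isNonZero_coe_root (s i).1) (he i) (hf i)
  have hroot (i j : ι) : (s i).1.1 (coroot (s j).1.1) = A i j := by
    rw [← rootSystem_pairing_apply, ← (rootSystem H).algebraMap_pairingIn ℤ, ← hs]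
    rfl
  have hspan : Submodule.span K (Set.range fun i => coroot (s i).1.1) = ⊤ := by
    rw [← b.toCoweightBasis.span_eq, ← s.surjective.range_comp]
    congr 2
    ext i
    simp
  have hH : H = lieSpan K L (Set.range h) := by
    refine le_antisymm (fun x hx => ?_) (lieSpan_le.2 ?_)
    · have hx' : (⟨x, hx⟩ : H) ∈ Submodule.span K (Set.range fun i => coroot (s i).1.1) :=
        hspan ▸ Submodule.mem_top
      have := Submodule.mem_map_of_mem (f := H.toSubmodule.subtype) hx'
      rw [Submodule.map_span, ← Set.range_comp] at this
      refine submodule_span_le_lieSpan ?_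
      have hcomp : H.toSubmodule.subtype ∘ (fun i => coroot (s i).1.1) = h :=
        funext fun i => (hh i).symm
      erw [hcomp] at this
      exact this
    · rintro _ ⟨i, rfl⟩
      simp [hh]
  refine ⟨{
    A := A
    h := h
    e := e
    f := f
    cartan_eq_lieSpan := hH
    span_ef := ?_
    linInd := ?_
    nondegen := hA
    sl2 := ht
    lie_h_h i j := ?_
    lie_h_e i j := ?_
    lie_h_f i j := ?_
    lie_e_f_ne i j hij := ?_ }, rfl⟩
  · have hmem (i : ι) : e i ∈ lieSpan K L (Set.range e ∪ Set.range f) ∧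
        f i ∈ lieSpan K L (Set.range e ∪ Set.range f) :=
      ⟨subset_lieSpan (.inl ⟨i, rfl⟩), subset_lieSpan (.inr ⟨i, rfl⟩)⟩
    refine lieSubalgebra_eq_top b ?_ fun i hi => ?_
    · nth_rw 1 [hH]
      refine lieSpan_le.2 ?_
      rintro _ ⟨i, rfl⟩
      rw [← (ht i).lie_e_f]
      exact LieSubalgebra.lie_mem _ (hmem i).1 (hmem i).2
    · obtain ⟨i, rfl⟩ : ∃ j, (s j).1 = i := ⟨s.symm ⟨i, hi⟩, by simp⟩
      exact ⟨rootSpace_le_of_mem (isNonZero_coe_root _) (he i) (ht i).e_ne_zero (hmem i).1,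
        rootSpace_le_of_mem (isNonZero_coe_root _).neg (hf i) (ht i).f_ne_zero (hmem i).2⟩
  · have h1 := (b.toCoweightBasis.linearIndependent.comp s s.injective).map' H.toSubmodule.subtype
      (Submodule.ker_subtype _)
    have hcomp : H.toSubmodule.subtype ∘ b.toCoweightBasis ∘ s = h := funext fun i => by
      simp [hh]
    rwa [hcomp] at h1
  · rw [hh, hh, ← LieSubalgebra.coe_bracket, trivial_lie_zero]
    rfl
  · rw [hh]
    refine (lie_eq_smul_of_mem_rootSpace (he i) _).trans ?_
    rw [hroot, Int.cast_smul_eq_zsmul]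
  · rw [hh]
    refine (lie_eq_smul_of_mem_rootSpace (hf i) _).trans ?_
    rw [Pi.neg_apply, hroot, ← Int.cast_neg, Int.cast_smul_eq_zsmul]
  · by_contra hne
    have hmem : ⁅e i, f j⁆ ∈ rootSpace H ((s i).1.1 + -(s j).1.1 : H → K) :=
      lie_mem_genWeightSpace_of_mem_genWeightSpace (he i) (hf j)
    have hbot : rootSpace H ((s i).1.1 + -(s j).1.1 : H → K) ≠ ⊥ := fun h0 =>
      hne (by rw [h0] at hmem; simpa using hmem)
    let W : Weight K H L := ⟨_, hbot⟩
    have hW : W.IsNonZero := by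
      intro h0
      refine hij (s.injective (Subtype.ext (Subtype.ext (Weight.ext fun x => ?_))))
      have := congrFun h0 x
      exact add_neg_eq_zero.1 this
    refine b.sub_notMem_range_root (s i).2 (s j).2
      ⟨⟨W, by simpa [LieSubalgebra.root] using hW⟩, ?_⟩
    ext x
    exact (sub_eq_add_neg _ _).symm

end LieAlgebra.IsKilling

lemma nondegenerate_cartanD4 : cartanD4.Nondegenerate :=
  Matrix.nondegenerate_of_det_ne_zero (by decide)

lemma LieAlgebra.exists_basis_cartanD4 {F L : Type*} [Field F] [IsAlgClosed F] [CharZero F]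
    [LieRing L] [LieAlgebra F L] [FiniteDimensional F L] [LieAlgebra.IsSimple F L]
    (hdim : Module.finrank F L = 28) (H : LieSubalgebra F L) [H.IsCartanSubalgebra] :
    ∃ B : LieAlgebra.Basis (Fin 4) H, B.A = cartanD4 := by
  have : Nontrivial L := Module.nontrivial_of_finrank_pos (R := F) (by omega)
  obtain ⟨b⟩ := (IsKilling.rootSystem H).nonempty_base
  obtain ⟨s, hs⟩ := b.exists_equiv_cartanD4 (by
    rw [Subspace.dual_finrank_eq, add_comm, IsKilling.finrank_add_card_root, hdim])
  exact IsKilling.exists_basis b s nondegenerate_cartanD4 hs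

namespace LieEquiv

lemma symm_trans_apply_eq {R L₁ L₂ L₃ : Type*} [CommRing R] [LieRing L₁] [LieRing L₂] [LieRing L₃]
    [LieAlgebra R L₁] [LieAlgebra R L₂] [LieAlgebra R L₃] (p : L₁ ≃ₗ⁅R⁆ L₂) (q : L₁ ≃ₗ⁅R⁆ L₃)
    {x : L₂} {y : L₃} (z : L₁) (hx : p z = x) (hy : q z = y) : p.symm.trans q x = y := by
  subst hx hy; simp

end LieEquiv

namespace LieAlgebra.Basis

variable {ι₁ ι₂ L₁ L₂ : Type*} [Finite ι₁] [Finite ι₂] (eι : ι₁ ≃ ι₂) [LieRing L₁] [LieRing L₂]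
variable {K : Type*} [Field K] [CharZero K]
  [LieAlgebra K L₁] [FiniteDimensional K L₁] {H₁ : LieSubalgebra K L₁} (b₁ : Basis ι₁ H₁)
  [LieAlgebra K L₂] [FiniteDimensional K L₂] {H₂ : LieSubalgebra K L₂} (b₂ : Basis ι₂ H₂)
  (hA : b₁.A.reindex eι eι = b₂.A)
variable [IsSimple K L₁] [IsSimple K L₂]

lemma equivOfReindex_e (i : ι₁) : equivOfReindex eι b₁ b₂ hA (b₁.e i) = b₂.e (eι i) := by
  unfold equivOfReindex
  exact LieEquiv.symm_trans_apply_eq _ _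
    ⟨(b₁.e i, b₂.e (eι i)), LieSubalgebra.subset_lieSpan (.inl (.inr ⟨i, rfl⟩))⟩ rfl rfl

lemma equivOfReindex_f (i : ι₁) : equivOfReindex eι b₁ b₂ hA (b₁.f i) = b₂.f (eι i) := by
  unfold equivOfReindex
  exact LieEquiv.symm_trans_apply_eq _ _
    ⟨(b₁.f i, b₂.f (eι i)), LieSubalgebra.subset_lieSpan (.inr ⟨i, rfl⟩)⟩ rfl rfl

end LieAlgebra.Basis

namespace LieAlgebra.Basis

open Function LieSubalgebra Module Set

variable {ι K L M : Type*} [Finite ι] [Field K] [LieRing L] [LieAlgebra K L]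
  [LieRing M] [LieAlgebra K M] {H : LieSubalgebra K L} (b : Basis ι H)

include b in
lemma hom_ext {φ ψ : L →ₗ⁅K⁆ M} (he : ∀ i, φ (b.e i) = ψ (b.e i))
    (hf : ∀ i, φ (b.f i) = ψ (b.f i)) (x : L) : φ x = ψ x := by
  have hx : x ∈ lieSpan K L (range b.e ∪ range b.f) := by simp [b.span_ef]
  induction hx using lieSpan_induction with
  | mem u hu => rcases hu with ⟨i, rfl⟩ | ⟨i, rfl⟩ <;> simp [he, hf]
  | zero => simp
  | add u v _ _ hu hv => simp [hu, hv]
  | smul t u _ hu => simp [hu]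
  | lie u v _ _ hu hv => simp [hu, hv]

lemma e_mem_top_of_le {S : LieSubalgebra K L} (he : ∀ i, b.e i ∈ S) (hf : ∀ i, b.f i ∈ S) :
    S = ⊤ := by
  rw [eq_top_iff, ← b.span_ef, lieSpan_le]
  rintro _ (⟨i, rfl⟩ | ⟨i, rfl⟩)
  exacts [he i, hf i]

/-- The basis obtained by rescaling the generators by a family of units. -/
@[simps]
def rescale (t : ι → Kˣ) : Basis ι H where
  A := b.A
  h := b.h
  e i := (t i : K) • b.e i
  f i := (↑(t i)⁻¹ : K) • b.f i
  cartan_eq_lieSpan := b.cartan_eq_lieSpan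
  span_ef := by
    refine b.e_mem_top_of_le (fun i => ?_) fun i => ?_
    · have := LieSubalgebra.smul_mem (lieSpan K L (range (fun i => (t i : K) • b.e i) ∪
        range fun i => (↑(t i)⁻¹ : K) • b.f i)) (↑(t i)⁻¹ : K) (subset_lieSpan (.inl ⟨i, rfl⟩))
      simpa [smul_smul] using this
    · have := LieSubalgebra.smul_mem (lieSpan K L (range (fun i => (t i : K) • b.e i) ∪
        range fun i => (↑(t i)⁻¹ : K) • b.f i)) (t i : K) (subset_lieSpan (.inr ⟨i, rfl⟩))
      simpa [smul_smul] using this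
  linInd := b.linInd
  nondegen := b.nondegen
  sl2 i :=
    { h_ne_zero := (b.sl2 i).h_ne_zero
      lie_e_f := by simp [smul_smul, (b.sl2 i).lie_e_f]
      lie_h_e_nsmul := by rw [lie_smul, (b.sl2 i).lie_h_e_nsmul, smul_comm]
      lie_h_f_nsmul := by rw [lie_smul, (b.sl2 i).lie_h_f_nsmul, smul_neg, smul_comm] }
  lie_h_h := b.lie_h_h
  lie_h_e i j := by rw [lie_smul, b.lie_h_e, smul_comm]
  lie_h_f i j := by rw [lie_smul, b.lie_h_f, smul_comm]
  lie_e_f_ne i j hij := by simp [b.lie_e_f_ne i j hij]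

/-- The iterated bracket `⁅e j₁, ⁅e j₂, … ⁅e jₙ, e i⁆ …⁆⁆` of the positive generators. -/
def word (i : ι) : List ι → L
  | [] => b.e i
  | j :: w => ⁅b.e j, word i w⁆

lemma lie_word {z : L} {a : ι → ℤ} (hz : ∀ i, ⁅z, b.e i⁆ = a i • b.e i) (i : ι) (w : List ι) :
    ⁅z, b.word i w⁆ = (a i + (w.map a).sum) • b.word i w := by
  induction w with
  | nil => simp [word, hz]
  | cons j w ih =>
    rw [word, leibniz_lie, hz, ih, smul_lie, lie_smul, ← add_smul]
    simp only [List.map_cons, List.sum_cons]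
    congr 1
    ring

lemma lie_f_e_of_ne {i j : ι} (hij : i ≠ j) : ⁅b.f i, b.e j⁆ = 0 := by
  rw [← lie_skew, b.lie_e_f_ne j i hij.symm, neg_zero]

lemma lie_f_e_self (i : ι) : ⁅b.f i, b.e i⁆ = -b.h i := by
  rw [← lie_skew, (b.sl2 i).lie_e_f]

lemma lie_f_word (i j : ι) (w : List ι) (hi : j ≠ i) (hw : j ∉ w) : ⁅b.f j, b.word i w⁆ = 0 := by
  induction w with
  | nil => exact b.lie_f_e_of_ne hi
  | cons k w ih =>
    simp only [List.mem_cons, not_or] at hw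
    rw [word, leibniz_lie, b.lie_f_e_of_ne hw.1, ih hw.2, zero_lie, lie_zero, add_zero]

variable [CharZero K]

lemma lie_e_ne_zero {i : ι} {y : L} {n : ℤ} (hy : y ≠ 0) (hn : n ≠ 0) (hf : ⁅b.f i, y⁆ = 0)
    (hh : ⁅b.h i, y⁆ = n • y) : ⁅b.e i, y⁆ ≠ 0 := by
  intro he
  rw [← (b.sl2 i).lie_e_f, lie_lie, hf, he, lie_zero, lie_zero, sub_zero,
    ← Int.cast_smul_eq_zsmul K] at hh
  exact smul_ne_zero (Int.cast_ne_zero.2 hn) hy hh.symm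

lemma word_cons_ne_zero {i j : ι} {w : List ι} (hw : b.word i w ≠ 0) (hji : j ≠ i) (hjw : j ∉ w)
    (hA : b.A i j + (w.map (b.A · j)).sum ≠ 0) : b.word i (j :: w) ≠ 0 :=
  b.lie_e_ne_zero hw hA (b.lie_f_word i j w hji hjw)
    (b.lie_word (a := (b.A · j)) (fun k => b.lie_h_e k j) i w)

lemma lie_e_e_eq_zero [FiniteDimensional K L] {i j : ι} (hij : i ≠ j) (hA : b.A i j = 0) :
    ⁅b.e i, b.e j⁆ = 0 := by
  by_contra hx
  have hp : (b.sl2 j).symm.HasPrimitiveVectorWith ⁅b.e i, b.e j⁆ (-2 : K) := by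
    refine ⟨hx, ?_, ?_⟩
    · rw [neg_lie, leibniz_lie, b.lie_h_e, hA, zero_smul, zero_lie, zero_add,
        (b.sl2 j).lie_h_e_nsmul, lie_nsmul, neg_smul, two_smul, two_smul]
    · rw [leibniz_lie, b.lie_f_e_of_ne hij.symm, zero_lie, zero_add, b.lie_f_e_self, lie_neg,
        lie_skew, b.lie_h_e, hA, zero_smul]
  obtain ⟨n, hn⟩ := hp.exists_nat
  have : ((n + 2 : ℕ) : K) = 0 := by push_cast; rw [← hn]; ring
  exact absurd (Nat.cast_eq_zero.1 this) (by omega)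

lemma word_ne_zero_of_cartanD4 [FiniteDimensional K L] {H : LieSubalgebra K L}
    (b : Basis (Fin 4) H) (hb : b.A = cartanD4) :
    b.word 0 [0, 3, 2, 1] ≠ 0 := by
  have h₁ : b.word 0 [3, 2, 1] ≠ 0 := by
    refine b.word_cons_ne_zero (b.word_cons_ne_zero (b.word_cons_ne_zero (b.sl2 0).e_ne_zero
      ?_ ?_ ?_) ?_ ?_ ?_) ?_ ?_ ?_ <;> (try rw [hb]) <;> decide
  refine b.lie_e_ne_zero (n := -1) h₁ (by decide) ?_ ?_
  · simp only [word]
    rw [leibniz_lie, leibniz_lie (b.f 0) (b.e 2), leibniz_lie (b.f 0) (b.e 1),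
      b.lie_f_e_of_ne (j := 1) (by decide), b.lie_f_e_of_ne (j := 2) (by decide),
      b.lie_f_e_of_ne (j := 3) (by decide), b.lie_f_e_self, lie_neg, lie_skew, b.lie_h_e]
    have := b.lie_e_e_eq_zero (i := 2) (j := 1) (by decide) (by rw [hb]; decide)
    simp [this]
  · rw [b.lie_word (a := (b.A · 0)) (fun k => b.lie_h_e k 0)]
    congr 1
    rw [hb]; decide

end LieAlgebra.Basis

namespace IsLieGrading

variable {F L A : Type*} [Field F] [LieRing L] [LieAlgebra F L]

/-- The Lie subalgebra spanned by a family of subspaces compatible with the bracket. -/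
def lieSubalgebra [AddCommGroup A] (gr : A → Submodule F L)
    (hgr : ∀ a b : A, ∀ x ∈ gr a, ∀ y ∈ gr b, ⁅x, y⁆ ∈ gr (a + b)) : LieSubalgebra F L where
  __ := ⨆ a, gr a
  lie_mem' {x y} hx hy := by
    change x ∈ ⨆ a, gr a at hx
    change y ∈ ⨆ a, gr a at hy
    change ⁅x, y⁆ ∈ ⨆ a, gr a
    refine Submodule.iSup_induction gr (motive := fun x => ⁅x, y⁆ ∈ ⨆ a, gr a) hx
      (fun a x hx => ?_) (by simp) fun u v hu hv => by rw [add_lie]; exact add_mem hu hv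
    exact Submodule.iSup_induction gr (motive := fun y => ⁅x, y⁆ ∈ ⨆ a, gr a) hy
      (fun b y hy => Submodule.mem_iSup_of_mem (a + b) (hgr a b x hx y hy)) (by simp)
      fun u v hu hv => by rw [lie_add]; exact add_mem hu hv

lemma mem_lieSubalgebra [AddCommGroup A] {gr : A → Submodule F L}
    {hgr : ∀ a b : A, ∀ x ∈ gr a, ∀ y ∈ gr b, ⁅x, y⁆ ∈ gr (a + b)} {x : L} :
    x ∈ lieSubalgebra gr hgr ↔ x ∈ ⨆ a, gr a := Iff.rfl

lemma iSup_eq_top_of_lieSubalgebra_eq_top [AddCommGroup A] {gr : A → Submodule F L}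
    {hgr : ∀ a b : A, ∀ x ∈ gr a, ∀ y ∈ gr b, ⁅x, y⁆ ∈ gr (a + b)}
    (h : lieSubalgebra gr hgr = ⊤) : ⨆ a, gr a = ⊤ := by
  rw [eq_top_iff]
  intro x _
  rw [← mem_lieSubalgebra (hgr := hgr), h]
  exact LieSubalgebra.mem_top x

lemma sum_finrank [AddCommGroup A] [DecidableEq A] [Fintype A] [FiniteDimensional F L]
    {gr : A → Submodule F L} (h : IsLieGrading F gr) : ∑ a, finrank F (gr a) = finrank F L := by
  rw [← (LinearEquiv.ofBijective (DirectSum.coeLinearMap gr) h.1).finrank_eq]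
  exact (finrank_directSum F (fun a => gr a)).symm

variable (F) in
/-- The nontrivial character `ZMod 2 → {1, -1}`. -/
def signChar (z : ZMod 2) : Fˣ := if z = 0 then 1 else -1

lemma signChar_add (a b : ZMod 2) : signChar F (a + b) = signChar F a * signChar F b := by
  have h (z : ZMod 2) : z = 0 ∨ z = 1 := by revert z; decide
  rcases h a with rfl | rfl <;> rcases h b with rfl | rfl <;>
    simp [signChar, show (1 : ZMod 2) + 1 = 0 from rfl]

lemma signChar_mul_self (a : ZMod 2) : signChar F a * signChar F a = 1 := by
  rw [← signChar_add, show a + a = 0 by revert a; decide, signChar, if_pos rfl]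

lemma signChar_inv (a : ZMod 2) : (signChar F a)⁻¹ = signChar F a :=
  inv_eq_of_mul_eq_one_right (signChar_mul_self a)

lemma signChar_injective [CharZero F] :
    Function.Injective (fun a : ZMod 2 => (signChar F a : F)) := by
  have h (b : ZMod 2) (hb : (signChar F b : F) = 1) : b = 0 := by
    by_contra h₀
    rw [signChar, if_neg h₀] at hb
    norm_num at hb
  intro a b hab
  have : a + b = 0 := h _ (by
    rw [signChar_add, Units.val_mul]
    change (signChar F a : F) = signChar F b at hab
    rw [hab, ← Units.val_mul, signChar_mul_self, Units.val_one])
  clear hab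
  revert a b
  decide

variable {κ : Type*} (θ : κ → L ≃ₗ⁅F⁆ L)

/-- The simultaneous eigenspaces with eigenvalues `±1` of a family of automorphisms. -/
def eigenGrading (x : κ → ZMod 2) : Submodule F L :=
  ⨅ k, Module.End.eigenspace (θ k).toLinearEquiv.toLinearMap (signChar F (x k) : F)

variable {θ}

lemma mem_eigenGrading {x : κ → ZMod 2} {y : L} :
    y ∈ eigenGrading θ x ↔ ∀ k, θ k y = (signChar F (x k) : F) • y := by
  simp [eigenGrading]

lemma lie_mem_eigenGrading (a b : κ → ZMod 2) (x : L) (hx : x ∈ eigenGrading θ a) (y : L)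
    (hy : y ∈ eigenGrading θ b) : ⁅x, y⁆ ∈ eigenGrading θ (a + b) := by
  rw [mem_eigenGrading] at *
  intro k
  rw [LieEquiv.map_lie, hx, hy, smul_lie, lie_smul, smul_smul, Pi.add_apply, signChar_add,
    Units.val_mul]

lemma eigenGrading_isLieGrading [CharZero F] [FiniteDimensional F L] [Fintype κ] [DecidableEq κ]
    (hθ : ∀ i j x, θ i (θ j x) = θ j (θ i x)) (htop : ⨆ x, eigenGrading θ x = ⊤) :
    IsLieGrading F (eigenGrading θ) := by
  refine ⟨DirectSum.isInternal_submodule_of_iSupIndep_of_iSup_eq_top ?_ htop,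
    lie_mem_eigenGrading⟩
  have h := Module.End.independent_iInf_maxGenEigenspace_of_forall_mapsTo
    (fun k => (θ k).toLinearEquiv.toLinearMap) (fun i j c =>
      Module.End.mapsTo_maxGenEigenspace_of_comm (LinearMap.ext fun x => hθ j i x) c)
  refine (h.comp (f := fun (x : κ → ZMod 2) k => (signChar F (x k) : F)) ?_).mono fun x => ?_
  · intro a b hab
    exact funext fun k => signChar_injective (congrFun hab k)
  · exact iInf_mono fun k => Module.End.eigenspace_le_maxGenEigenspace

end IsLieGrading

namespace LieAlgebra.Basis

open IsLieGrading

variable {K L : Type*} [Field K] [CharZero K] [LieRing L] [LieAlgebra K L]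
  [FiniteDimensional K L] [IsSimple K L] {H : LieSubalgebra K L}

section

variable {ι : Type*} [Finite ι] (b : Basis ι H)

/-- The automorphism interchanging the generators `e` and `f`. -/
noncomputable def chevalley : L ≃ₗ⁅K⁆ L := equivOfReindex (.refl ι) b b.symm (by ext; rfl)

@[simp] lemma chevalley_e (i : ι) : b.chevalley (b.e i) = b.f i := equivOfReindex_e _ _ _ _ i

@[simp] lemma chevalley_f (i : ι) : b.chevalley (b.f i) = b.e i := equivOfReindex_f _ _ _ _ i

lemma chevalley_h (i : ι) : b.chevalley (b.h i) = -b.h i := by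
  rw [← (b.sl2 i).lie_e_f, LieEquiv.map_lie, chevalley_e, chevalley_f, lie_skew]

/-- The automorphism changing the signs of the generators according to `c`. -/
noncomputable def signAut (c : ι → ZMod 2) : L ≃ₗ⁅K⁆ L :=
  equivOfReindex (.refl ι) b (b.rescale fun i => signChar K (c i)) (by ext; rfl)

@[simp] lemma signAut_e (c : ι → ZMod 2) (i : ι) :
    b.signAut c (b.e i) = (signChar K (c i) : K) • b.e i := equivOfReindex_e _ _ _ _ i

@[simp] lemma signAut_f (c : ι → ZMod 2) (i : ι) :
    b.signAut c (b.f i) = (signChar K (c i) : K) • b.f i := by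
  refine (equivOfReindex_f _ _ _ _ i).trans ?_
  simp [rescale, -Units.val_inv_eq_inv_val, signChar_inv]

lemma signAut_h (c : ι → ZMod 2) (i : ι) : b.signAut c (b.h i) = b.h i := by
  rw [← (b.sl2 i).lie_e_f, LieEquiv.map_lie, signAut_e, signAut_f, smul_lie, lie_smul, smul_smul,
    ← Units.val_mul, signChar_mul_self, Units.val_one, one_smul]

lemma signAut_word (c : ι → ZMod 2) (i : ι) (w : List ι) :
    b.signAut c (b.word i w) = (signChar K (c i + (w.map c).sum) : K) • b.word i w := by
  induction w with
  | nil => simp [word]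
  | cons j w ih =>
    rw [word, LieEquiv.map_lie, signAut_e, ih, smul_lie, lie_smul, smul_smul, ← Units.val_mul,
      ← signChar_add]
    simp only [List.map_cons, List.sum_cons]
    rw [add_left_comm]

lemma signAut_comm (c d : ι → ZMod 2) (x : L) :
    b.signAut c (b.signAut d x) = b.signAut d (b.signAut c x) := by
  refine b.hom_ext (φ := (b.signAut c).toLieHom.comp (b.signAut d).toLieHom)
    (ψ := (b.signAut d).toLieHom.comp (b.signAut c).toLieHom) (fun i => ?_) (fun i => ?_) x <;>
    simp [smul_smul, mul_comm]

lemma signAut_chevalley (c : ι → ZMod 2) (x : L) :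
    b.signAut c (b.chevalley x) = b.chevalley (b.signAut c x) := by
  refine b.hom_ext (φ := (b.signAut c).toLieHom.comp b.chevalley.toLieHom)
    (ψ := b.chevalley.toLieHom.comp (b.signAut c).toLieHom) (fun i => ?_) (fun i => ?_) x <;>
    simp

lemma chevalley_chevalley (x : L) : b.chevalley (b.chevalley x) = x := by
  refine b.hom_ext (φ := b.chevalley.toLieHom.comp b.chevalley.toLieHom)
    (ψ := LieHom.id) (fun i => ?_) (fun i => ?_) x <;> simp

/-- The commuting automorphisms of order two attached to a family of signs. -/
noncomputable def involutions {n : ℕ} (c : Fin n → ι → ZMod 2) : Fin (n + 1) → L ≃ₗ⁅K⁆ L :=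
  Fin.cons b.chevalley fun k => b.signAut (c k)

lemma involutions_comm {n : ℕ} (c : Fin n → ι → ZMod 2) (i j : Fin (n + 1)) (x : L) :
    b.involutions c i (b.involutions c j x) = b.involutions c j (b.involutions c i x) := by
  induction i using Fin.cases <;> induction j using Fin.cases <;>
    simp [involutions, signAut_comm _ (c _) (c _), signAut_chevalley]

lemma mem_eigenGrading_involutions {n : ℕ} (c : Fin n → ι → ZMod 2) {x : Fin (n + 1) → ZMod 2}
    {y : L} : y ∈ eigenGrading (b.involutions c) x ↔
      b.chevalley y = (signChar K (x 0) : K) • y ∧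
      ∀ k, b.signAut (c k) y = (signChar K (x k.succ) : K) • y := by
  rw [mem_eigenGrading, Fin.forall_fin_succ]
  rfl

lemma add_smul_chevalley_mem {n : ℕ} (c : Fin n → ι → ZMod 2) {x : Fin (n + 1) → ZMod 2} {y : L}
    (hy : ∀ k, b.signAut (c k) y = (signChar K (x k.succ) : K) • y) :
    y + (signChar K (x 0) : K) • b.chevalley y ∈ eigenGrading (b.involutions c) x := by
  rw [mem_eigenGrading_involutions]
  refine ⟨?_, fun k => ?_⟩
  · rw [map_add, map_smul, chevalley_chevalley, smul_add, smul_smul, ← Units.val_mul,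
      signChar_mul_self, Units.val_one, one_smul, add_comm]
  · rw [map_add, map_smul, signAut_chevalley, hy, map_smul, smul_add, smul_comm]

lemma iSup_eigenGrading_involutions {n : ℕ} (c : Fin n → ι → ZMod 2) :
    ⨆ x, eigenGrading (b.involutions c) x = ⊤ := by
  refine iSup_eq_top_of_lieSubalgebra_eq_top (hgr := lie_mem_eigenGrading) ?_
  have key (i : ι) (z : ZMod 2) : b.e i + (signChar K z : K) • b.f i ∈
      ⨆ x, eigenGrading (b.involutions c) x := by
    have := b.add_smul_chevalley_mem c (x := Fin.cons z fun k => c k i) (y := b.e i)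
      (fun k => by simp)
    rw [chevalley_e] at this
    exact Submodule.mem_iSup_of_mem _ this
  have h₀ (i : ι) := key i 0
  have h₁ (i : ι) := key i 1
  simp only [signChar, if_pos, one_ne_zero, if_false, Units.val_one, one_smul, Units.val_neg,
    neg_smul] at h₀ h₁
  have h₂ : (2 : K) ≠ 0 := two_ne_zero
  refine b.e_mem_top_of_le (fun i => ?_) fun i => ?_
  · have := Submodule.smul_mem _ (2⁻¹ : K) (add_mem (h₀ i) (h₁ i))
    rw [mem_lieSubalgebra]
    convert this using 1
    rw [add_add_add_comm, add_neg_cancel, add_zero, ← two_smul K, smul_smul, inv_mul_cancel₀ h₂,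
      one_smul]
  · have := Submodule.smul_mem _ (2⁻¹ : K) (sub_mem (h₀ i) (h₁ i))
    rw [mem_lieSubalgebra]
    convert this using 1
    rw [add_sub_add_left_eq_sub, sub_neg_eq_add, ← two_smul K, smul_smul, inv_mul_cancel₀ h₂,
      one_smul]

lemma involutions_isLieGrading {n : ℕ} (c : Fin n → ι → ZMod 2) :
    IsLieGrading K (eigenGrading (b.involutions c)) :=
  eigenGrading_isLieGrading (b.involutions_comm c) (b.iSup_eigenGrading_involutions c)

lemma card_le_finrank_of_eq_one {n : ℕ} (c : Fin n → ι → ZMod 2) {x : Fin (n + 1) → ZMod 2}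
    (h₀ : x 0 = 1) (h₁ : ∀ k : Fin n, x k.succ = 0) :
    Nat.card ι ≤ finrank K (eigenGrading (b.involutions c) x) := by
  have := Fintype.ofFinite ι
  have hm (i : ι) : b.h i ∈ eigenGrading (b.involutions c) x := by
    rw [mem_eigenGrading_involutions]
    simp [h₀, h₁, chevalley_h, signAut_h, signChar]
  rw [Nat.card_eq_fintype_card]
  refine LinearIndependent.fintype_card_le_finrank (b := fun i => ⟨b.h i, hm i⟩) ?_
  exact LinearIndependent.of_comp (Submodule.subtype _) b.linInd

lemma card_le_finrank_of_word {n : ℕ} (c : Fin n → ι → ZMod 2) {x : Fin (n + 1) → ZMod 2}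
    {κ : Type*} [Fintype κ] (s : κ → ι) (w : κ → List ι) (hw : ∀ k, b.word (s k) (w k) ≠ 0)
    (hc : ∀ l k, c l (s k) + ((w k).map (c l)).sum = x l.succ) {z : L} {a : ι → ℤ}
    (hz : ∀ i, ⁅z, b.e i⁆ = a i • b.e i) (hz' : b.chevalley z = -z)
    (ha : ∀ k, a (s k) + ((w k).map a).sum ≠ 0)
    (hinj : Function.Injective fun k => (a (s k) + ((w k).map a).sum) ^ 2) :
    Fintype.card κ ≤ finrank K (eigenGrading (b.involutions c) x) := by
  set μ : κ → ℤ := fun k => a (s k) + ((w k).map a).sum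
  set ε : K := (signChar K (x 0) : K)
  let y (k : κ) : L := b.word (s k) (w k)
  have hy₁ (k : κ) : ⁅z, y k⁆ = (μ k : K) • y k := by
    rw [Int.cast_smul_eq_zsmul]
    exact b.lie_word hz _ _
  have hy₂ (k : κ) : ⁅z, b.chevalley (y k)⁆ = -((μ k : K) • b.chevalley (y k)) := by
    rw [← neg_neg z, ← hz', neg_lie, ← LieEquiv.map_lie, hy₁, map_smul]
  let u (k : κ) : L := y k + ε • b.chevalley (y k)
  have hu₁ (k : κ) : ⁅z, u k⁆ = (μ k : K) • (y k - ε • b.chevalley (y k)) := by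
    rw [lie_add, lie_smul, hy₁, hy₂, smul_sub, smul_neg, ← sub_eq_add_neg, smul_comm ε]
  have hu₂ (k : κ) : ⁅z, ⁅z, u k⁆⁆ = ((μ k) ^ 2 : K) • u k := by
    rw [hu₁, lie_smul, lie_sub, lie_smul, hy₁, hy₂, smul_neg, sub_neg_eq_add, smul_comm ε,
      ← smul_add, smul_smul, sq]
  have hu₀ (k : κ) : u k ≠ 0 := by
    intro h
    have h' := hu₁ k
    rw [h, lie_zero, eq_comm, smul_eq_zero_iff_right (Int.cast_ne_zero.2 (ha k))] at h'
    have : (2 : K) • y k = 0 := by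
      rw [two_smul, ← add_zero 0]
      nth_rw 1 [← h]
      rw [← h']
      simp only [u]
      abel
    exact hw k ((smul_eq_zero_iff_right two_ne_zero).1 this)
  have hm (k : κ) : u k ∈ eigenGrading (b.involutions c) x := by
    refine b.add_smul_chevalley_mem c fun l => ?_
    rw [signAut_word, hc]
  refine LinearIndependent.fintype_card_le_finrank (b := fun k => ⟨u k, hm k⟩) ?_
  refine LinearIndependent.of_comp (Submodule.subtype _) ?_
  refine Module.End.eigenvectors_linearIndependent' (LieAlgebra.ad K L z ∘ₗ LieAlgebra.ad K L z)
    (fun k => ((μ k) ^ 2 : K)) ?_ u fun k => ?_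
  · intro k l hkl
    refine hinj (Int.cast_injective (α := K) ?_)
    simpa only [Int.cast_pow] using hkl
  · exact ⟨Module.End.mem_eigenspace_iff.2 (hu₂ k), hu₀ k⟩

end

/-- The parities of the simple roots of type `D₄` defining a grading with components of
dimension four. -/
def parityD4 : Fin 2 → Fin 4 → ZMod 2 := ![![1, 0, 0, 0], ![0, 1, 1, 1]]

/-- The values on the simple roots of type `D₄` of a coweight separating enough roots. -/
def coweightD4 : Fin 4 → ℤ := ![-8, 1, 5, 13]

lemma exists_isLieGrading_of_cartanD4 (b : Basis (Fin 4) H) (hb : b.A = cartanD4)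
    (hdim : finrank K L = 28) : ∃ gr : (Fin 3 → ZMod 2) → Submodule K L, IsLieGrading K gr ∧
      ∀ a : Fin 3 → ZMod 2, a ≠ 0 → finrank K (gr a) = 4 := by
  let z : L := ∑ j, (![3, 2, 4, 8] : Fin 4 → ℤ) j • b.h j
  have hz' : b.chevalley z = -z := by
    simp [z, Fin.sum_univ_four, chevalley_h]
    abel
  have hz (i : Fin 4) : ⁅z, b.e i⁆ = coweightD4 i • b.e i := by
    have : coweightD4 i = ∑ j, (![3, 2, 4, 8] : Fin 4 → ℤ) j * cartanD4 i j := by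
      revert i; decide
    simp only [this, z, sum_lie, smul_lie, b.lie_h_e, hb, smul_smul, Finset.sum_smul]
  have hgr := b.involutions_isLieGrading parityD4
  refine ⟨_, hgr, ?_⟩
  have hle (x : Fin 3 → ZMod 2) (hx : x ≠ 0) :
      4 ≤ finrank K (eigenGrading (b.involutions parityD4) x) := by
    have hx' : (x 0 = 1 ∧ x 1 = 0 ∧ x 2 = 0) ∨ (x 1 = 1 ∧ x 2 = 0) ∨ (x 1 = 0 ∧ x 2 = 1) ∨
        (x 1 = 1 ∧ x 2 = 1) := by
      revert x; decide
    have hword (i j : Fin 4) (w : List (Fin 4)) (hw : b.word i w ≠ 0)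
      (h : j ≠ i ∧ j ∉ w ∧ cartanD4 i j + (w.map (cartanD4 · j)).sum ≠ 0) :
        b.word i (j :: w) ≠ 0 :=
      b.word_cons_ne_zero hw h.1 h.2.1 (hb ▸ h.2.2)
    have hnil (i : Fin 4) : b.word i [] ≠ 0 := (b.sl2 i).e_ne_zero
    rcases hx' with h | h | h | h
    · simpa using b.card_le_finrank_of_eq_one parityD4 h.1
        (fun k => by fin_cases k; exacts [h.2.1, h.2.2])
    · refine b.card_le_finrank_of_word parityD4 ![0, 0, 0, 0] ![[], [2, 1], [3, 1], [3, 2]] ?_ ?_ hz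
        hz' (by decide) (by decide)
      · intro k
        fin_cases k
        exacts [hnil 0,
          hword 0 2 [1] (hword 0 1 [] (hnil 0) (by decide)) (by decide),
          hword 0 3 [1] (hword 0 1 [] (hnil 0) (by decide)) (by decide),
          hword 0 3 [2] (hword 0 2 [] (hnil 0) (by decide)) (by decide)]
      · refine Fin.forall_fin_two.2 ⟨fun k => Eq.trans (b := 1) ?_ h.1.symm,
          fun k => Eq.trans (b := 0) ?_ h.2.symm⟩ <;> revert k <;> decide
    · refine b.card_le_finrank_of_word parityD4 ![1, 2, 3, 0] ![[], [], [], [0, 3, 2, 1]] ?_ ?_ hz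
        hz' (by decide) (by decide)
      · intro k
        fin_cases k
        exacts [hnil 1,
          hnil 2,
          hnil 3,
          b.word_ne_zero_of_cartanD4 hb]
      · refine Fin.forall_fin_two.2 ⟨fun k => Eq.trans (b := 0) ?_ h.1.symm,
          fun k => Eq.trans (b := 1) ?_ h.2.symm⟩ <;> revert k <;> decide
    · refine b.card_le_finrank_of_word parityD4 ![0, 0, 0, 0] ![[1], [2], [3], [3, 2, 1]] ?_ ?_ hz
        hz' (by decide) (by decide)
      · intro k
        fin_cases k
        exacts [hword 0 1 [] (hnil 0) (by decide),
          hword 0 2 [] (hnil 0) (by decide),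
          hword 0 3 [] (hnil 0) (by decide),
          hword 0 3 [2, 1] (hword 0 2 [1] (hword 0 1 [] (hnil 0) (by decide)) (by decide))
            (by decide)]
      · refine Fin.forall_fin_two.2 ⟨fun k => Eq.trans (b := 1) ?_ h.1.symm,
          fun k => Eq.trans (b := 1) ?_ h.2.symm⟩ <;> revert k <;> decide
  have hsum := hgr.sum_finrank
  rw [hdim, ← Finset.add_sum_erase _ _ (Finset.mem_univ 0)] at hsum
  have hle' : ∀ x ∈ Finset.univ.erase (0 : Fin 3 → ZMod 2),
      4 ≤ finrank K (eigenGrading (b.involutions parityD4) x) :=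
    fun x hx => hle x (Finset.ne_of_mem_erase hx)
  have h₄ : ∑ x ∈ Finset.univ.erase (0 : Fin 3 → ZMod 2), 4 = 28 := by decide
  have := (Finset.sum_eq_sum_iff_of_le hle').1
    (le_antisymm (Finset.sum_le_sum hle')
    (((Nat.le_add_left _ _).trans hsum.le).trans h₄.ge))
  exact fun x hx => (this x (Finset.mem_erase.2 ⟨hx, Finset.mem_univ x⟩)).symm

end LieAlgebra.Basis

namespace LieAlgebra.IsKilling

variable {F L : Type*} [Field F] [IsAlgClosed F] [CharZero F] [LieRing L] [LieAlgebra F L]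
  [FiniteDimensional F L] [IsKilling F L]

open Module.End in
lemma exists_isSemisimple_ad_isNilpotent_ad_sub (x : L) :
    ∃ y : L, (ad F L y).IsSemisimple ∧ _root_.IsNilpotent (ad F L (x - y)) ∧
      ∀ W : Submodule F L, (∀ w ∈ W, ⁅x, w⁆ ∈ W) → ∀ w ∈ W, ⁅y, w⁆ ∈ W := by
  obtain ⟨N, -, S, hS₁, hN, hS, hSN⟩ := (ad F L x).exists_isNilpotent_isSemisimple
  have hS₀ : Commute (ad F L x) S := Algebra.commute_of_mem_adjoin_self hS₁
  have aux {μ : F} {y : L} (hy : y ∈ (ad F L x).maxGenEigenspace μ) : S y = μ • y := by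
    rw [maxGenEigenspace_eq] at hy
    exact apply_eq_of_mem_of_comm_of_isFinitelySemisimple_of_isNil hy hS₀ hS.isFinitelySemisimple
      (by rwa [hSN, add_sub_cancel_right])
  have h_der (y z : L) : S ⁅y, z⁆ = ⁅S y, z⁆ + ⁅y, S z⁆ := by
    have hy : y ∈ ⨆ μ, (ad F L x).maxGenEigenspace μ := by
      simp [Module.End.iSup_maxGenEigenspace_eq_top]
    have hz : z ∈ ⨆ μ, (ad F L x).maxGenEigenspace μ := by
      simp [Module.End.iSup_maxGenEigenspace_eq_top]
    refine Submodule.iSup_induction _ (motive := fun y => S ⁅y, z⁆ = ⁅S y, z⁆ + ⁅y, S z⁆) hy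
      (fun μ y hy => ?_) (by simp) fun u v hu hv => by
        rw [add_lie, map_add, hu, hv, map_add, add_lie, add_lie]; abel
    refine Submodule.iSup_induction _ (motive := fun z => S ⁅y, z⁆ = ⁅S y, z⁆ + ⁅y, S z⁆) hz
      (fun ν z hz => ?_) (by simp) fun u v hu hv => by
        rw [lie_add, map_add, hu, hv, map_add, lie_add, lie_add]; abel
    have hyz : ⁅y, z⁆ ∈ (ad F L x).maxGenEigenspace (μ + ν) :=
      LieModule.lie_mem_maxGenEigenspace_toEnd hy hz
    rw [aux hy, aux hz, aux hyz, smul_lie, lie_smul, ← add_smul]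
  let S' : LieDerivation F L L := ⟨S, fun y z => by
    rw [h_der, ← lie_skew (S y) z, add_comm, ← sub_eq_add_neg]⟩
  obtain ⟨y, hy⟩ := LieDerivation.IsKilling.exists_eq_ad S'
  have hyS : S = ad F L y := by rw [← LieDerivation.coe_ad_apply_eq_ad_apply, hy]
  refine ⟨y, hyS ▸ hS, by rwa [map_sub, hSN, hyS, add_sub_cancel_right], fun W hW w hw => ?_⟩
  have hSW : ∀ w ∈ W, S w ∈ W := by
    refine Algebra.adjoin_induction (p := fun f _ => ∀ w ∈ W, f w ∈ W) ?_ ?_ ?_ ?_ hS₁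
    · rintro f rfl
      exact hW
    · exact fun r w hw => W.smul_mem r hw
    · exact fun f g _ _ hf hg w hw => W.add_mem (hf w hw) (hg w hw)
    · exact fun f g _ _ hf hg w hw => hf _ (hg w hw)
  simpa only [hyS, ad_apply] using hSW w hw

end LieAlgebra.IsKilling

namespace IsLieGrading

variable {F L A : Type*} [Field F] [LieRing L] [LieAlgebra F L] [AddCommGroup A] [DecidableEq A]
  {gr : A → Submodule F L} (h : IsLieGrading F gr)

include h in
lemma isInternal : DirectSum.IsInternal gr := h.1

/-- The projection to a homogeneous component of a grading. -/
noncomputable def proj (a : A) : L →ₗ[F] L :=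
  (gr a).subtype ∘ₗ DirectSum.component F A (fun a => gr a) a ∘ₗ
    (LinearEquiv.ofBijective (DirectSum.coeLinearMap gr) h.isInternal).symm.toLinearMap

lemma proj_mem (a : A) (x : L) : h.proj a x ∈ gr a := Submodule.coe_mem _

lemma proj_apply_of_mem {a : A} {x : L} (hx : x ∈ gr a) (b : A) :
    h.proj b x = DirectSum.of (fun a => gr a) a ⟨x, hx⟩ b := by
  have : (LinearEquiv.ofBijective (DirectSum.coeLinearMap gr) h.isInternal).symm x =
      DirectSum.of (fun a => gr a) a ⟨x, hx⟩ := by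
    rw [LinearEquiv.symm_apply_eq]
    exact (DirectSum.coeLinearMap_of gr a ⟨x, hx⟩).symm
  simp only [proj, LinearMap.comp_apply, LinearEquiv.coe_coe, this, Submodule.subtype_apply]
  rfl

lemma proj_of_mem {a : A} {x : L} (hx : x ∈ gr a) : h.proj a x = x := by
  rw [h.proj_apply_of_mem hx, DirectSum.of_eq_same]

lemma proj_of_mem_of_ne {a b : A} {x : L} (hx : x ∈ gr a) (hab : a ≠ b) : h.proj b x = 0 := by
  rw [h.proj_apply_of_mem hx, DirectSum.of_eq_of_ne _ _ _ hab.symm, Submodule.coe_zero]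

include h in
lemma mem_iSup (x : L) : x ∈ ⨆ a, gr a := by
  rw [h.1.submodule_iSup_eq_top]; trivial

include h in
lemma induction {P : L → Prop} (hmem : ∀ a, ∀ x ∈ gr a, P x) (h_zero : P 0)
    (h_add : ∀ x y, P x → P y → P (x + y)) (x : L) : P x :=
  Submodule.iSup_induction gr (motive := P) (h.mem_iSup x) hmem h_zero h_add

lemma proj_lie_left {c : A} {y : L} (hy : y ∈ gr c) (b : A) (x : L) :
    h.proj (b + c) ⁅x, y⁆ = ⁅h.proj b x, y⁆ := by
  refine h.induction (P := fun x => h.proj (b + c) ⁅x, y⁆ = ⁅h.proj b x, y⁆)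
    (fun a x hx => ?_) (by simp) (fun u v hu hv => ?_) x
  · have := h.2 a c x hx y hy
    rcases eq_or_ne a b with rfl | hab
    · rw [h.proj_of_mem this, h.proj_of_mem hx]
    · rw [h.proj_of_mem_of_ne this (by simpa using hab), h.proj_of_mem_of_ne hx hab, zero_lie]
  · rw [add_lie, map_add, hu, hv, map_add, add_lie]

lemma sum_proj [Fintype A] (x : L) : ∑ a, h.proj a x = x := by
  refine h.induction (P := fun x => ∑ a, h.proj a x = x)
    (fun a x hx => ?_) (by simp) (fun u v hu hv => ?_) x
  · rw [Finset.sum_eq_single a (fun b _ hb => h.proj_of_mem_of_ne hx hb.symm) (by simp),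
      h.proj_of_mem hx]
  · simp only [map_add, Finset.sum_add_distrib, hu, hv]

include h in
lemma lie_eq_zero {a : A} (ha : a + a = 0) (h₀ : gr 0 = ⊥) {x y : L} (hx : x ∈ gr a)
    (hy : y ∈ gr a) : ⁅x, y⁆ = 0 := by
  have := h.2 a a x hx y hy
  rwa [ha, h₀] at this

include h in
lemma killingForm_eq_zero [FiniteDimensional F L] {b c : A} (hbc : b + c ≠ 0) {x y : L}
    (hx : x ∈ gr b) (hy : y ∈ gr c) : killingForm F L x y = 0 := by
  rw [killingForm_apply_apply]
  refine LinearMap.trace_eq_zero_of_mapsTo_ne h.1 (fun d => b + (c + d)) (fun d => ?_)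
    fun d z hz => h.2 _ _ _ hx _ (h.2 _ _ _ hy _ hz)
  rwa [← add_assoc, ne_eq, add_eq_right]

variable [FiniteDimensional F L] [LieAlgebra.IsKilling F L]

include h in
lemma eq_zero_of_killingForm_eq_zero {a : A} {x : L} (hx : x ∈ gr a)
    (hκ : ∀ y ∈ gr (-a), killingForm F L x y = 0) : x = 0 := by
  have : x ∈ LinearMap.ker (killingForm F L) := by
    refine LinearMap.mem_ker.2 (LinearMap.ext fun y => ?_)
    refine h.induction (P := fun y => killingForm F L x y = 0)
      (fun b y hy => ?_) (by simp) (fun u v hu hv => ?_) y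
    · by_cases hab : a + b = 0
      · exact hκ y (neg_eq_of_add_eq_zero_right hab ▸ hy)
      · exact h.killingForm_eq_zero hab hx hy
    · rw [map_add, hu, hv, add_zero]
  simpa using this

include h in
lemma eq_zero_of_forall_lie_eq_zero {x : L} (hx : ∀ a, ∀ y ∈ gr a, ⁅x, y⁆ = 0) : x = 0 := by
  have : x ∈ LieAlgebra.center F L := fun y => by
    rw [← lie_skew, neg_eq_zero]
    exact h.induction (P := fun y => ⁅x, y⁆ = 0) hx (by simp) (fun u v hu hv => by simp [hu, hv]) y
  simpa using this

variable [IsAlgClosed F] [CharZero F] [Fintype A]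

include h in
lemma isSemisimple_ad {a : A} (ha : a + a = 0) (h₀ : gr 0 = ⊥) {x : L} (hx : x ∈ gr a) :
    (LieAlgebra.ad F L x).IsSemisimple := by
  obtain ⟨y, hy, hn, hW⟩ :=
    LieAlgebra.IsKilling.exists_isSemisimple_ad_isNilpotent_ad_sub (F := F) x
  have hna : x - y ∈ gr a := by
    have hproj (c : A) (hc : c ≠ a) : h.proj c (x - y) = 0 := by
      by_cases hc₀ : c = 0
      · have := h.proj_mem c (x - y)
        rwa [hc₀, h₀, Submodule.mem_bot, ← hc₀] at this
      refine h.eq_zero_of_forall_lie_eq_zero fun b v hv => ?_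
      rw [← h.proj_lie_left hv]
      have hxW : ∀ w ∈ gr b ⊔ gr (a + b), ⁅x, w⁆ ∈ gr b ⊔ gr (a + b) := by
        intro w hw
        obtain ⟨u, hu, v, hv, rfl⟩ := Submodule.mem_sup.1 hw
        rw [lie_add]
        refine add_mem (Submodule.mem_sup_right (h.2 _ _ _ hx _ hu)) (Submodule.mem_sup_left ?_)
        have := h.2 _ _ _ hx _ hv
        rwa [← add_assoc, ha, zero_add] at this
      have hv' := Submodule.mem_sup_left (T := gr (a + b)) hv
      obtain ⟨u, hu, w, hw, huw⟩ := Submodule.mem_sup.1 (sub_mem (hxW v hv') (hW _ hxW v hv'))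
      rw [sub_lie, ← huw, map_add, h.proj_of_mem_of_ne hu (by simpa using hc₀),
        h.proj_of_mem_of_ne hw (by simpa using hc.symm), add_zero]
    rw [← h.sum_proj (x - y), Finset.sum_eq_single a (fun b _ hb => hproj b hb) (by simp)]
    exact h.proj_mem a _
  have : x - y = 0 := by
    refine h.eq_zero_of_killingForm_eq_zero hna fun z hz => ?_
    rw [neg_eq_of_add_eq_zero_left ha] at hz
    have comm : Commute (LieAlgebra.ad F L (x - y)) (LieAlgebra.ad F L z) := by
      refine LinearMap.ext fun w => ?_
      simp only [Module.End.mul_apply, LieAlgebra.ad_apply]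
      rw [leibniz_lie, h.lie_eq_zero ha h₀ hna hz, zero_lie, zero_add]
    rw [killingForm_apply_apply]
    exact (LinearMap.isNilpotent_trace_of_isNilpotent (comm.isNilpotent_mul_right hn)).eq_zero
  rwa [sub_eq_zero.1 this]

end IsLieGrading

namespace LieSubalgebra

variable {F L : Type*} [Field F] [LieRing L] [LieAlgebra F L]

/-- The centralizer of a subspace of a Lie algebra. -/
def centralizerSubmodule (T : Submodule F L) : LieSubalgebra F L where
  carrier := {x | ∀ t ∈ T, ⁅t, x⁆ = 0}
  add_mem' hx hy t ht := by rw [lie_add, hx t ht, hy t ht, add_zero]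
  zero_mem' t _ := lie_zero t
  smul_mem' c x hx t ht := by rw [lie_smul, hx t ht, smul_zero]
  lie_mem' hx hy t ht := by rw [leibniz_lie, hx t ht, hy t ht, zero_lie, lie_zero, add_zero]

lemma exists_isCartanSubalgebra_of_isSemisimple_ad [Infinite F] [FiniteDimensional F L]
    {T : Submodule F L} (hT : ∀ x ∈ T, ∀ y ∈ T, ⁅x, y⁆ = 0)
    (hs : ∀ x ∈ T, (LieAlgebra.ad F L x).IsSemisimple) :
    ∃ H : LieSubalgebra F L, H.IsCartanSubalgebra ∧ T ≤ H.toSubmodule := by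
  let C := centralizerSubmodule T
  obtain ⟨x, hx⟩ := LieAlgebra.exists_isCartanSubalgebra_engel F C
  set H' := engel F x
  let H := (C.incl.comp H'.incl).range
  have hH (y : L) : y ∈ H ↔ ∃ hy : y ∈ C, (⟨y, hy⟩ : C) ∈ H' := by
    constructor
    · rintro ⟨⟨⟨y, hy⟩, hy'⟩, rfl⟩
      exact ⟨hy, hy'⟩
    · rintro ⟨hy, hy'⟩
      exact ⟨⟨⟨y, hy⟩, hy'⟩, rfl⟩
  have hTC (y : L) (hy : y ∈ T) : y ∈ C := fun t ht => hT t ht y hy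
  have hTH : T ≤ H.toSubmodule := by
    intro y hy
    refine (hH y).2 ⟨hTC y hy, ?_⟩
    rw [← hx.self_normalizing, mem_normalizer_iff]
    intro z _
    have : ⁅(⟨y, hTC y hy⟩ : C), z⁆ = 0 := Subtype.ext (z.2 y hy)
    rw [this]
    exact zero_mem _
  refine ⟨H, ⟨?_, le_antisymm (fun y hy => ?_) H.le_normalizer⟩, hTH⟩
  · have := hx.nilpotent
    exact Function.Surjective.lieAlgebra_isNilpotent
      (f := (C.incl.comp H'.incl).rangeRestrict) (LieHom.surjective_rangeRestrict _)
  · rw [mem_normalizer_iff'] at hy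
    have hyC : y ∈ C := by
      intro t ht
      obtain ⟨h₁, -⟩ := (hH _).1 (hy t (hTH ht))
      have h₂ : ((LieAlgebra.ad F L t) ^ 2) y = 0 := by
        simpa [pow_two] using h₁ t ht
      have h₃ : y ∈ (LieAlgebra.ad F L t).eigenspace 0 := by
        rw [← (hs t ht).isFinitelySemisimple.maxGenEigenspace_eq_eigenspace,
          Module.End.mem_maxGenEigenspace]
        exact ⟨2, by simpa using h₂⟩
      simpa using h₃
    refine (hH y).2 ⟨hyC, ?_⟩
    rw [← hx.self_normalizing, mem_normalizer_iff']
    intro z hz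
    exact ((hH _).1 (hy z ((hH _).2 ⟨z.2, hz⟩))).2

end LieSubalgebra

namespace LieAlgebra

lemma Basis.finrank_cartan {ι F L : Type*} [Fintype ι] [Field F] [LieRing L] [LieAlgebra F L]
    {H : LieSubalgebra F L} (b : Basis ι H) : finrank F H = Fintype.card ι := by
  have := finrank_span_eq_card b.linInd
  rwa [← b.coe_cartan_eq_span] at this

lemma IsKilling.exists_eq_smul_of_lie_eq_smul {F L : Type*} [Field F] [CharZero F]
    [IsAlgClosed F] [LieRing L] [LieAlgebra F L] [FiniteDimensional F L] [IsKilling F L]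
    {H : LieSubalgebra F L} [H.IsCartanSubalgebra] {χ : H → F} {h₀ : H} (hχ : χ h₀ ≠ 0)
    {x y : L} (hx₀ : x ≠ 0) (hx : ∀ h : H, ⁅(h : L), x⁆ = χ h • x)
    (hy : ∀ h : H, ⁅(h : L), y⁆ = χ h • y) : ∃ c : F, y = c • x := by
  have mem {z : L} (hz : ∀ h : H, ⁅(h : L), z⁆ = χ h • z) : z ∈ rootSpace H χ := by
    rw [LieModule.mem_genWeightSpace]
    exact fun h => ⟨1, by simpa [sub_eq_zero] using hz h⟩
  have hne : rootSpace H χ ≠ ⊥ := fun h => hx₀ (by simpa [h] using mem hx)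
  let α : LieModule.Weight F H L := ⟨χ, hne⟩
  have hα : α.IsNonZero := fun h => hχ (congrFun h h₀)
  obtain ⟨c, hc⟩ := (finrank_eq_one_iff_of_nonzero' (⟨x, mem hx⟩ : rootSpace H α)
    (by simpa using hx₀)).1 (finrank_rootSpace_eq_one α hα) ⟨y, mem hy⟩
  exact ⟨c, (congrArg Subtype.val hc).symm⟩

end LieAlgebra

lemma IsLieGrading.exists_basis_cartanD4 {F L A : Type*} [Field F] [IsAlgClosed F] [CharZero F]
    [LieRing L] [LieAlgebra F L] [FiniteDimensional F L] [LieAlgebra.IsSimple F L]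
    [AddCommGroup A] [DecidableEq A] [Fintype A] {gr : A → Submodule F L}
    (h : IsLieGrading F gr) (hdim : finrank F L = 28) (h₀ : gr 0 = ⊥) {a : A} (ha : a + a = 0)
    (h₄ : finrank F (gr a) = 4) :
    ∃ (H : LieSubalgebra F L) (b : LieAlgebra.Basis (Fin 4) H), H.IsCartanSubalgebra ∧
      b.A = cartanD4 ∧ H.toSubmodule = gr a := by
  obtain ⟨H, hH, hle⟩ := LieSubalgebra.exists_isCartanSubalgebra_of_isSemisimple_ad
    (fun x hx y hy => h.lie_eq_zero ha h₀ hx hy) fun x hx => h.isSemisimple_ad ha h₀ hx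
  obtain ⟨b, hb⟩ := LieAlgebra.exists_basis_cartanD4 hdim H
  refine ⟨H, b, hH, hb, (Submodule.eq_of_le_of_finrank_eq hle ?_).symm⟩
  exact h₄.trans (b.finrank_cartan.trans (by simp)).symm

namespace LieAlgebra.Basis

lemma exists_lie_eq_smul {ι F L : Type*} [Finite ι] [Field F] [LieRing L] [LieAlgebra F L]
    {H : LieSubalgebra F L} (b : Basis ι H) (i : ι) :
    ∃ χ : H → F, ∀ h : H, ⁅(h : L), b.e i⁆ = χ h • b.e i ∧ ⁅(h : L), b.f i⁆ = -χ h • b.f i := by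
  have (h : H) : ∃ c : F, ⁅(h : L), b.e i⁆ = c • b.e i ∧ ⁅(h : L), b.f i⁆ = -c • b.f i := by
    have hh : (h : L) ∈ Submodule.span F (Set.range b.h) := by
      rw [← b.coe_cartan_eq_span, LieSubalgebra.mem_toSubmodule]
      exact h.2
    generalize (h : L) = x at hh
    induction hh using Submodule.span_induction with
    | mem x hx =>
      obtain ⟨j, rfl⟩ := hx
      refine ⟨(b.A i j : F), ?_, ?_⟩
      · rw [b.lie_h_e, Int.cast_smul_eq_zsmul]
      · rw [b.lie_h_f, neg_smul, neg_smul, Int.cast_smul_eq_zsmul]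
    | zero => exact ⟨0, by simp⟩
    | add x y _ _ hx hy =>
      obtain ⟨c, hc, hc'⟩ := hx
      obtain ⟨d, hd, hd'⟩ := hy
      refine ⟨c + d, ?_, ?_⟩
      · rw [add_lie, hc, hd, add_smul]
      · rw [add_lie, hc', hd', neg_add, add_smul]
    | smul r x _ hx =>
      obtain ⟨c, hc, hc'⟩ := hx
      refine ⟨r * c, ?_, ?_⟩
      · rw [smul_lie, hc, smul_smul]
      · rw [smul_lie, hc', smul_smul, mul_neg]
  choose χ hχ using this
  exact ⟨χ, hχ⟩

variable {F L A : Type*} [Field F] [IsAlgClosed F] [CharZero F] [LieRing L] [LieAlgebra F L]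
  [FiniteDimensional F L] [IsKilling F L] [AddCommGroup A] [DecidableEq A] [Fintype A]
  {gr : A → Submodule F L} {H : LieSubalgebra F L} {ι : Type*} [Finite ι]

open IsLieGrading in
lemma exists_homogeneous_parts (h : IsLieGrading F gr) (h₀ : gr 0 = ⊥) {a : A} (ha : a + a = 0)
    {P : A → Prop} (hP : ∀ c, P c ∨ P (c + a)) [H.IsCartanSubalgebra]
    (hH : H.toSubmodule = gr a) (b : Basis ι H) (i : ι) :
    ∃ (t : Fˣ) (d : A), P d ∧ d ≠ 0 ∧ d + a ≠ 0 ∧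
      (t : F) • b.e i - (↑t⁻¹ : F) • b.f i ∈ gr d ∧
      (t : F) • b.e i + (↑t⁻¹ : F) • b.f i ∈ gr (d + a) := by
  obtain ⟨χ, hχ⟩ := b.exists_lie_eq_smul i
  have hmem : b.h i ∈ H := by
    rw [← LieSubalgebra.mem_toSubmodule, b.coe_cartan_eq_span]
    exact Submodule.subset_span ⟨i, rfl⟩
  let h₁ : H := ⟨b.h i, hmem⟩
  have hi : χ h₁ ≠ 0 := by
    intro hi
    have := (b.sl2 i).lie_h_e_nsmul
    rw [(hχ h₁).1, hi, zero_smul, eq_comm, ← Nat.cast_smul_eq_nsmul F] at this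
    exact smul_ne_zero (by norm_num) (b.sl2 i).e_ne_zero this
  have hHa (z : H) : (z : L) ∈ gr a := hH ▸ z.2
  have hproj (c : A) (z : H) : ⁅(z : L), h.proj c (b.e i)⁆ = χ z • h.proj (c + a) (b.e i) := by
    have := h.proj_lie_left (hHa z) c (b.e i)
    rw [← lie_skew, (hχ z).1, ← lie_skew, map_neg, map_smul, neg_inj] at this
    exact this.symm
  obtain ⟨d, hPd, hd⟩ : ∃ d, P d ∧ h.proj d (b.e i) ≠ 0 := by
    obtain ⟨c, hc⟩ : ∃ c, h.proj c (b.e i) ≠ 0 := by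
      by_contra! hd
      apply (b.sl2 i).e_ne_zero
      rw [← h.sum_proj (b.e i)]
      exact Finset.sum_eq_zero fun c _ => hd c
    refine (hP c).elim (fun hPc => ⟨c, hPc, hc⟩) fun hPc => ⟨c + a, hPc, fun hc' => ?_⟩
    have := hproj (c + a) h₁
    rw [hc', lie_zero, add_assoc, ha, add_zero] at this
    exact smul_ne_zero hi hc this.symm
  have hproj' (z : H) : ⁅(z : L), h.proj (d + a) (b.e i)⁆ = χ z • h.proj d (b.e i) := by
    rw [hproj, add_assoc, ha, add_zero]
  have hproj := hproj d
  set u := h.proj d (b.e i)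
  set v := h.proj (d + a) (b.e i)
  have hu : u ∈ gr d := h.proj_mem d _
  have hv : v ∈ gr (d + a) := h.proj_mem (d + a) _
  have hv₀ : v ≠ 0 := by
    intro hv₀
    have := hproj' h₁
    rw [hv₀, lie_zero] at this
    exact (smul_ne_zero hi hd) this.symm
  have hne {c : A} {w : L} (hw : w ∈ gr c) (hw₀ : w ≠ 0) : c ≠ 0 := by
    rintro rfl
    rw [h₀] at hw
    exact hw₀ hw
  obtain ⟨p, hp⟩ := IsKilling.exists_eq_smul_of_lie_eq_smul hi (b.sl2 i).e_ne_zero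
    (fun z => (hχ z).1) (y := u + v) fun z => by
      rw [lie_add, hproj, hproj', ← smul_add, add_comm v]
  obtain ⟨q, hq⟩ := IsKilling.exists_eq_smul_of_lie_eq_smul (χ := fun z => -χ z) (neg_ne_zero.2 hi)
    (b.sl2 i).f_ne_zero (fun z => (hχ z).2) (y := v - u) fun z => by
      rw [lie_sub, hproj, hproj', ← smul_sub, neg_smul, ← smul_neg, neg_sub]
  have hda : d ≠ d + a := fun hda => by
    rw [left_eq_add] at hda
    have hz : b.h i ∈ gr a := hHa h₁
    rw [hda, h₀] at hz
    exact (b.sl2 i).h_ne_zero hz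
  have huv {s : F} (hs : v = s • u) : False := by
    have := h.proj_of_mem_of_ne ((gr d).smul_mem s hu) hda
    rw [← hs, h.proj_of_mem hv] at this
    exact hv₀ this
  have hp₀ : p ≠ 0 := by
    rintro rfl
    rw [zero_smul] at hp
    exact huv (s := -1) (by rw [neg_one_smul, eq_neg_iff_add_eq_zero, add_comm, hp])
  have hq₀ : q ≠ 0 := by
    rintro rfl
    rw [zero_smul] at hq
    exact huv (s := 1) (by rw [one_smul, ← sub_eq_zero, hq])
  obtain ⟨s, hs⟩ := IsAlgClosed.exists_pow_nat_eq (p * q)⁻¹ (n := 2) (by norm_num)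
  have hs₀ : s ≠ 0 := by
    rintro rfl
    have : (p * q)⁻¹ ≠ 0 := inv_ne_zero (mul_ne_zero hp₀ hq₀)
    exact this (by rw [← hs]; simp)
  have hspq : s * p * (s * q) = 1 := by
    rw [show s * p * (s * q) = s ^ 2 * (p * q) by ring, hs,
      inv_mul_cancel₀ (mul_ne_zero hp₀ hq₀)]
  refine ⟨⟨s * p, s * q, hspq, by rw [mul_comm, hspq]⟩, d, hPd, hne hu hd, hne hv hv₀, ?_, ?_⟩
  · have : (s * p) • b.e i - (s * q) • b.f i = (2 * s) • u := by
      rw [mul_smul, mul_smul, ← hp, ← hq]; module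
    exact this ▸ (gr d).smul_mem _ hu
  · have : (s * p) • b.e i + (s * q) • b.f i = (2 * s) • v := by
      rw [mul_smul, mul_smul, ← hp, ← hq]; module
    exact this ▸ (gr (d + a)).smul_mem _ hv

lemma exists_homogeneous_rescale (h : IsLieGrading F gr) (h₀ : gr 0 = ⊥) {a : A} (ha : a + a = 0)
    {P : A → Prop} (hP : ∀ c, P c ∨ P (c + a)) [H.IsCartanSubalgebra]
    (hH : H.toSubmodule = gr a) (b : Basis ι H) :
    ∃ (b' : Basis ι H) (d : ι → A), b'.A = b.A ∧ ∀ i, P (d i) ∧ d i ≠ 0 ∧ d i + a ≠ 0 ∧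
      b'.e i - b'.f i ∈ gr (d i) ∧ b'.e i + b'.f i ∈ gr (d i + a) := by
  choose t d hd using b.exists_homogeneous_parts h h₀ ha hP hH
  exact ⟨b.rescale t, d, rfl, hd⟩

end LieAlgebra.Basis

namespace IsLieGrading

variable {F L A : Type*} [Field F] [LieRing L] [LieAlgebra F L] [AddCommGroup A] [DecidableEq A]
  {gr : A → Submodule F L}

lemma lie_mem_sup (h : IsLieGrading F gr) {a c d : A}
    (ha : a + a = 0) {x y : L} (hx : x ∈ gr c ⊔ gr (c + a)) (hy : y ∈ gr d ⊔ gr (d + a)) :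
    ⁅x, y⁆ ∈ gr (c + d) ⊔ gr (c + d + a) := by
  obtain ⟨x₁, hx₁, x₂, hx₂, rfl⟩ := Submodule.mem_sup.1 hx
  obtain ⟨y₁, hy₁, y₂, hy₂, rfl⟩ := Submodule.mem_sup.1 hy
  rw [add_lie, lie_add, lie_add]
  have h₁ := h.2 _ _ _ hx₁ _ hy₁
  have h₂ := h.2 _ _ _ hx₁ _ hy₂
  have h₃ := h.2 _ _ _ hx₂ _ hy₁
  have h₄ := h.2 _ _ _ hx₂ _ hy₂
  rw [← add_assoc] at h₂
  rw [add_right_comm] at h₃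
  rw [add_add_add_comm, ha, add_zero] at h₄
  exact add_mem (add_mem (Submodule.mem_sup_left h₁) (Submodule.mem_sup_right h₂))
    (add_mem (Submodule.mem_sup_right h₃) (Submodule.mem_sup_left h₄))

open LieAlgebra in
lemma degree_ne_zero_of_word_ne_zero [CharZero F] {ι : Type*} [Finite ι] {H : LieSubalgebra F L}
    (h : IsLieGrading F gr) (h₀ : gr 0 = ⊥) {a : A} (ha : a + a = 0) (hH : H.toSubmodule = gr a)
    (b : Basis ι H) {d : ι → A} (hd : ∀ i, b.e i ∈ gr (d i) ⊔ gr (d i + a)) {i : ι} {w : List ι}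
    (hw : b.word i w ≠ 0) {k : ι} (hk : b.A i k + (w.map (b.A · k)).sum ≠ 0) :
    d i + (w.map d).sum ≠ 0 := by
  intro h_sum
  have hmem (w : List ι) :
      b.word i w ∈ gr (d i + (w.map d).sum) ⊔ gr (d i + (w.map d).sum + a) := by
    induction w with
    | nil => simpa [Basis.word] using hd i
    | cons j w ih =>
      have := h.lie_mem_sup ha (hd j) ih
      rwa [List.map_cons, List.sum_cons, add_left_comm]
  have hwa := hmem w
  rw [h_sum, h₀, bot_sup_eq, zero_add] at hwa
  have hka : b.h k ∈ gr a := by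
    rw [← hH, b.coe_cartan_eq_span]
    exact Submodule.subset_span ⟨k, rfl⟩
  have := h.lie_eq_zero ha h₀ hka hwa
  rw [b.lie_word (a := (b.A · k)) (fun j => b.lie_h_e j k), ← Int.cast_smul_eq_zsmul F] at this
  exact smul_ne_zero (Int.cast_ne_zero.2 hk) hw this

end IsLieGrading

/-- The homomorphism `(ZMod 2)³ → A` sending the standard basis vectors to given elements. -/
def cubeHom {A : Type*} [AddCommGroup A] [Module (ZMod 2) A] (a c d : A) :
    (Fin 3 → ZMod 2) →+ A :=
  AddMonoidHom.mk' (fun s => s 0 • a + s 1 • c + s 2 • d) fun s t => by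
    simp only [Pi.add_apply, add_smul]; abel

lemma cubeHom_apply {A : Type*} [AddCommGroup A] [Module (ZMod 2) A] (a c d : A) (x y z : ZMod 2) :
    cubeHom a c d ![x, y, z] = x • a + y • c + z • d := rfl

lemma eq_zero_iff_of_apply_zero {p : Fin 3 → ZMod 2} (hp : p 0 = 0) :
    p = 0 ↔ p 1 = 0 ∧ p 2 = 0 := by
  simp [funext_iff, Fin.forall_fin_succ, hp]

lemma eq_of_add_ne_zero_of_zmod_two {p q r : Fin 3 → ZMod 2} (hp₀ : p 0 = 0) (hq₀ : q 0 = 0)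
    (hr₀ : r 0 = 0) (hp : p ≠ 0) (hq : q ≠ 0) (hr : r ≠ 0) (hpq : p + q ≠ 0) (hpr : p + r ≠ 0)
    (h : p + (r + q) ≠ 0) : r = q := by
  have key : ∀ p₁ p₂ q₁ q₂ r₁ r₂ : ZMod 2, ¬ (p₁ = 0 ∧ p₂ = 0) → ¬ (q₁ = 0 ∧ q₂ = 0) →
      ¬ (r₁ = 0 ∧ r₂ = 0) → ¬ (p₁ + q₁ = 0 ∧ p₂ + q₂ = 0) → ¬ (p₁ + r₁ = 0 ∧ p₂ + r₂ = 0) →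
      ¬ (p₁ + (r₁ + q₁) = 0 ∧ p₂ + (r₂ + q₂) = 0) → r₁ = q₁ ∧ r₂ = q₂ := by decide
  rw [ne_eq, eq_zero_iff_of_apply_zero (by simp [*])] at hp hq hr hpq hpr h
  obtain ⟨h₁, h₂⟩ := key _ _ _ _ _ _ hp hq hr hpq hpr h
  ext i
  fin_cases i
  exacts [hr₀.trans hq₀.symm, h₁, h₂]

lemma cubeHom_injective {c d : Fin 3 → ZMod 2} (hc₀ : c 0 = 0) (hd₀ : d 0 = 0) (hc : c ≠ 0)
    (hd : d ≠ 0) (hcd : d + c ≠ 0) : Function.Injective (cubeHom ![1, 0, 0] c d) := by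
  rw [injective_iff_map_eq_zero]
  intro s hs
  have key : ∀ c₁ c₂ d₁ d₂ s₁ s₂ : ZMod 2, ¬ (c₁ = 0 ∧ c₂ = 0) → ¬ (d₁ = 0 ∧ d₂ = 0) →
      ¬ (d₁ + c₁ = 0 ∧ d₂ + c₂ = 0) → s₁ * c₁ + s₂ * d₁ = 0 → s₁ * c₂ + s₂ * d₂ = 0 →
      s₁ = 0 ∧ s₂ = 0 := by decide
  rw [ne_eq, eq_zero_iff_of_apply_zero (by simp [*])] at hc hd hcd
  have hs' (i : Fin 3) :
      s 0 * (![1, 0, 0] : Fin 3 → ZMod 2) i + s 1 * c i + s 2 * d i = 0 := congrFun hs i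
  have hs₀ : s 0 = 0 := by simpa [hc₀, hd₀] using hs' 0
  have hs₁ : s 1 * c 1 + s 2 * d 1 = 0 := by simpa using hs' 1
  have hs₂ : s 1 * c 2 + s 2 * d 2 = 0 := by simpa using hs' 2
  exact (eq_zero_iff_of_apply_zero hs₀).2 (key _ _ _ _ _ _ hc hd hcd hs₁ hs₂)

/-- The degrees, in suitable coordinates, of the elements `e i - f i` for a basis of type `D₄`
adapted to a grading by `(ZMod 2)³` with components of dimension four. -/
def degreeD4 (i : Fin 4) : Fin 3 → ZMod 2 := if i = 0 then ![0, 0, 1] else ![0, 1, 0]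

lemma IsLieGrading.exists_adapted_basis {F L : Type*} [Field F] [IsAlgClosed F] [CharZero F]
    [LieRing L] [LieAlgebra F L] [FiniteDimensional F L] [LieAlgebra.IsSimple F L]
    {gr : (Fin 3 → ZMod 2) → Submodule F L} (h : IsLieGrading F gr) (hdim : finrank F L = 28)
    (h₀ : gr 0 = ⊥) (h₄ : ∀ a ≠ 0, finrank F (gr a) = 4) :
    ∃ (H : LieSubalgebra F L) (b : LieAlgebra.Basis (Fin 4) H)
      (τ : (Fin 3 → ZMod 2) →+ (Fin 3 → ZMod 2)), b.A = cartanD4 ∧ Function.Injective τ ∧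
      ∀ i, b.e i - b.f i ∈ gr (τ (degreeD4 i)) ∧
        b.e i + b.f i ∈ gr (τ (degreeD4 i + ![1, 0, 0])) := by
  have ha : (![1, 0, 0] : Fin 3 → ZMod 2) + ![1, 0, 0] = 0 := by decide
  obtain ⟨H, b₀, hH, hb₀, hHa⟩ := h.exists_basis_cartanD4 hdim h₀ ha (h₄ _ (by decide))
  obtain ⟨b, d, hb, hd⟩ := b₀.exists_homogeneous_rescale h h₀ ha (P := fun c => c 0 = 0)
    (fun c => by
      have : ∀ z : ZMod 2, z = 0 ∨ z + 1 = 0 := by decide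
      exact this (c 0)) hHa
  rw [hb₀] at hb
  have he (i : Fin 4) : b.e i ∈ gr (d i) ⊔ gr (d i + ![1, 0, 0]) := by
    have : b.e i = (2⁻¹ : F) • (b.e i - b.f i) + (2⁻¹ : F) • (b.e i + b.f i) := by module
    rw [this]
    exact add_mem (Submodule.mem_sup_left (Submodule.smul_mem _ _ (hd i).2.2.2.1))
      (Submodule.mem_sup_right (Submodule.smul_mem _ _ (hd i).2.2.2.2))
  have hword (i : Fin 4) (hi : i ≠ 0) : b.word 0 [i] ≠ 0 := by
    refine b.word_cons_ne_zero (b.sl2 0).e_ne_zero hi (by simp) ?_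
    rw [hb]
    revert i; decide
  have h₁ (i : Fin 4) (hi : i ≠ 0) : d 0 + d i ≠ 0 := by
    have := h.degree_ne_zero_of_word_ne_zero h₀ ha hHa b he (hword i hi) (k := 0)
      (by rw [hb]; revert i; decide)
    simpa using this
  have h₂ (i : Fin 4) (hi : i ≠ 0) : d i = d 1 := by
    by_cases hi₁ : i = 1
    · rw [hi₁]
    refine eq_of_add_ne_zero_of_zmod_two (hd 0).1 (hd 1).1 (hd i).1 (hd 0).2.1 (hd 1).2.1
      (hd i).2.1 (h₁ 1 (by decide)) (h₁ i hi) ?_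
    have hw : b.word 0 [i, 1] ≠ 0 := by
      refine b.word_cons_ne_zero (hword 1 (by decide)) hi (by simpa using hi₁) ?_
      rw [hb]
      revert i; decide
    have := h.degree_ne_zero_of_word_ne_zero h₀ ha hHa b he hw (k := 1)
      (by rw [hb]; clear hw; revert i; decide)
    simpa using this
  refine ⟨H, b, cubeHom ![1, 0, 0] (d 1) (d 0), hb, cubeHom_injective (hd 1).1 (hd 0).1
    (hd 1).2.1 (hd 0).2.1 (h₁ 1 (by decide)), fun i => ?_⟩
  have hτ : cubeHom ![1, 0, 0] (d 1) (d 0) (degreeD4 i) = d i := by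
    by_cases hi : i = 0
    · rw [degreeD4, if_pos hi, hi, cubeHom_apply, zero_smul, zero_smul, zero_add, zero_add,
        one_smul]
    · rw [degreeD4, if_neg hi, h₂ i hi, cubeHom_apply, zero_smul, zero_smul, zero_add, add_zero,
        one_smul]
  have hτ₁ : cubeHom ![1, 0, 0] (d 1) (d 0) ![1, 0, 0] = ![1, 0, 0] := by
    rw [cubeHom_apply, one_smul, zero_smul, zero_smul, add_zero, add_zero]
  rw [map_add, hτ, hτ₁]
  exact (hd i).2.2.2

lemma LieAlgebra.Basis.map_mem_of_generators {ι F L M A A' B : Type*} [Finite ι] [Field F]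
    [CharZero F] [LieRing L] [LieAlgebra F L] [LieRing M] [LieAlgebra F M]
    [AddCommGroup A] [DecidableEq A] [AddCommGroup A'] [DecidableEq A'] [AddCommGroup B]
    {gr : A → Submodule F L} {gr' : A' → Submodule F M} (h : IsLieGrading F gr)
    (h' : IsLieGrading F gr') {H : LieSubalgebra F L} (b : Basis ι H) (φ : L →ₗ⁅F⁆ M)
    {τ : B →+ A} {τ' : B →+ A'} (hτ : Function.Injective τ) (hτ' : Function.Injective τ')
    {p q : ι → B}
    (hp : ∀ i, b.e i - b.f i ∈ gr (τ (p i)) ∧ φ (b.e i - b.f i) ∈ gr' (τ' (p i)))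
    (hq : ∀ i, b.e i + b.f i ∈ gr (τ (q i)) ∧ φ (b.e i + b.f i) ∈ gr' (τ' (q i)))
    {s : B} {x : L} (hx : x ∈ gr (τ s)) : φ x ∈ gr' (τ' s) := by
  let S (s : B) : Submodule F L := gr (τ s) ⊓ (gr' (τ' s)).comap φ.toLinearMap
  have hS : ∀ s t : B, ∀ x ∈ S s, ∀ y ∈ S t, ⁅x, y⁆ ∈ S (s + t) := by
    rintro s t x ⟨hx, hx'⟩ y ⟨hy, hy'⟩
    refine ⟨?_, ?_⟩
    · rw [map_add]
      exact h.2 _ _ _ hx _ hy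
    · change φ ⁅x, y⁆ ∈ gr' (τ' (s + t))
      rw [map_add, LieHom.map_lie]
      exact h'.2 _ _ _ hx' _ hy'
  have hpS (i : ι) : b.e i - b.f i ∈ ⨆ s, S s := Submodule.mem_iSup_of_mem (p i) (hp i)
  have hqS (i : ι) : b.e i + b.f i ∈ ⨆ s, S s := Submodule.mem_iSup_of_mem (q i) (hq i)
  have h_top : ⨆ s, S s = ⊤ := by
    refine IsLieGrading.iSup_eq_top_of_lieSubalgebra_eq_top (hgr := hS)
      (b.e_mem_top_of_le (fun i => ?_) fun i => ?_) <;> rw [IsLieGrading.mem_lieSubalgebra]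
    · have : b.e i = (2⁻¹ : F) • ((b.e i - b.f i) + (b.e i + b.f i)) := by module
      exact this ▸ Submodule.smul_mem _ _ (add_mem (hpS i) (hqS i))
    · have : b.f i = (2⁻¹ : F) • ((b.e i + b.f i) - (b.e i - b.f i)) := by module
      exact this ▸ Submodule.smul_mem _ _ (sub_mem (hqS i) (hpS i))
  have key : φ (h.proj (τ s) x) = h'.proj (τ' s) (φ x) := by
    refine Submodule.iSup_induction S
      (motive := fun x => φ (h.proj (τ s) x) = h'.proj (τ' s) (φ x))
      (h_top ▸ Submodule.mem_top : x ∈ ⨆ s, S s) (fun t y hy => ?_) (by simp)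
      fun u v hu hv => by simp only [map_add, hu, hv]
    have hy' : φ y ∈ gr' (τ' t) := hy.2
    rcases eq_or_ne t s with rfl | hts
    · rw [h.proj_of_mem hy.1, h'.proj_of_mem hy']
    · rw [h.proj_of_mem_of_ne hy.1 (hτ.ne hts), h'.proj_of_mem_of_ne hy' (hτ'.ne hts), map_zero]
  rw [h.proj_of_mem hx] at key
  exact key ▸ h'.proj_mem _ _

theorem jordan_grading_D4 (F : Type*) [Field F] [IsAlgClosed F] [CharZero F]
    (L : Type*) [LieRing L] [LieAlgebra F L] [FiniteDimensional F L]
    [LieAlgebra.IsSimple F L] (hdim : finrank F L = 28) :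
    (∃ gr : (Fin 3 → ZMod 2) → Submodule F L, IsLieGrading F gr ∧
      ∀ a : Fin 3 → ZMod 2, a ≠ 0 → finrank F (gr a) = 4) ∧
    ∀ gr gr' : (Fin 3 → ZMod 2) → Submodule F L,
      IsLieGrading F gr → (∀ a : Fin 3 → ZMod 2, a ≠ 0 → finrank F (gr a) = 4) →
      IsLieGrading F gr' → (∀ a : Fin 3 → ZMod 2, a ≠ 0 → finrank F (gr' a) = 4) →
      GradingsEquiv F gr gr' := by
  refine ⟨?_, fun gr gr' h h₄ h' h₄' => ?_⟩
  · obtain ⟨x, hx⟩ := LieAlgebra.exists_isCartanSubalgebra_engel F L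
    obtain ⟨b, hb⟩ := LieAlgebra.exists_basis_cartanD4 hdim (LieSubalgebra.engel F x)
    exact b.exists_isLieGrading_of_cartanD4 hb hdim
  have zero_eq_bot {gr : (Fin 3 → ZMod 2) → Submodule F L} (h : IsLieGrading F gr)
      (h₄ : ∀ a : Fin 3 → ZMod 2, a ≠ 0 → finrank F (gr a) = 4) : gr 0 = ⊥ := by
    have hsum := h.sum_finrank
    rw [hdim, ← Finset.add_sum_erase _ _ (Finset.mem_univ 0),
      Finset.sum_congr rfl fun a ha => h₄ a (Finset.ne_of_mem_erase ha)] at hsum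
    simp at hsum
    exact hsum
  have h₀ := zero_eq_bot h h₄
  obtain ⟨H, b, τ, hb, hτ, hbτ⟩ := h.exists_adapted_basis hdim h₀ h₄
  obtain ⟨H', b', τ', hb', hτ', hbτ'⟩ := h'.exists_adapted_basis hdim (zero_eq_bot h' h₄') h₄'
  let φ : L ≃ₗ⁅F⁆ L := LieAlgebra.Basis.equivOfReindex (.refl _) b b' (by rw [hb, hb']; ext; rfl)
  have hφe (i : Fin 4) : φ (b.e i) = b'.e i := LieAlgebra.Basis.equivOfReindex_e _ _ _ _ i
  have hφf (i : Fin 4) : φ (b.f i) = b'.f i := LieAlgebra.Basis.equivOfReindex_f _ _ _ _ i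
  refine ⟨φ, fun a ha => ?_⟩
  obtain ⟨s, rfl⟩ := (Finite.injective_iff_surjective.1 hτ) a
  have hs₀ : s ≠ 0 := by
    rintro rfl
    rw [map_zero] at ha
    exact ha h₀
  refine ⟨τ' s, Submodule.eq_of_le_of_finrank_eq ?_ ?_⟩
  · rintro - ⟨x, hx, rfl⟩
    refine b.map_mem_of_generators h h' φ.toLieHom hτ hτ' (p := degreeD4)
      (q := fun i => degreeD4 i + ![1, 0, 0]) (fun i => ⟨(hbτ i).1, ?_⟩)
      (fun i => ⟨(hbτ i).2, ?_⟩) hx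
    · change φ (b.e i - b.f i) ∈ _
      rw [map_sub, hφe, hφf]
      exact (hbτ' i).1
    · change φ (b.e i + b.f i) ∈ _
      rw [map_add φ, hφe, hφf]
      exact (hbτ' i).2
  · rw [LinearEquiv.finrank_map_eq, h₄ _ ((map_ne_zero_iff τ hτ).2 hs₀),
      h₄' _ ((map_ne_zero_iff τ' hτ').2 hs₀)]
end

section
/- Let F be an algebraically closed field of characteristic 0, let n ≥ 1, and let g be a finite-dimensional simple Lie algebra over F equipped with a grading by ℤ/nℤ: g = ⊕_{i∈ℤ/nℤ} g_i with ⁅g_i, g_j⁆ ⊆ g_{i+j}. Assume that g_1 generates g as a Lie algebra and that g_1 is a nonzero irreducible module over the Lie subalgebra g_0 (acting by the adjoint action). Let σ be a Lie algebra automorphism of g such that σ(g_i) = g_i for every i and σ(x) = x for all x ∈ g_0. Then there exists λ ∈ F with λ^n = 1 such that σ(x) = λ^i · x for all x ∈ g_i and every i ∈ {0, 1, ..., n−1}. -/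
open Module

/-- An element killed by a generating set of a simple Lie algebra is zero. -/
theorem eq_zero_of_lieSpan_eq_top_of_forall_lie_eq_zero
    {F L : Type*} [Field F] [LieRing L] [LieAlgebra F L] [LieAlgebra.IsSimple F L]
    {s : Set L} (hs : LieSubalgebra.lieSpan F L s = ⊤) {z : L}
    (hz : ∀ x ∈ s, ⁅x, z⁆ = 0) : z = 0 := by
  have hall : ∀ x : L, ⁅x, z⁆ = 0 := by
    intro x
    have hx : x ∈ LieSubalgebra.lieSpan F L s := hs ▸ LieSubalgebra.mem_top x
    induction hx using LieSubalgebra.lieSpan_induction with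
    | mem x h => exact hz x h
    | zero => simp
    | add x y _ _ h₁ h₂ => simp [h₁, h₂]
    | smul a x _ h => simp [h]
    | lie x y _ _ h₁ h₂ => simp [lie_lie, h₁, h₂]
  have hc : z ∈ LieAlgebra.center F L := by
    rw [LieModule.mem_maxTrivSubmodule]
    exact hall
  have hb : LieAlgebra.center F L = ⊥ := LieAlgebra.center_eq_bot F L
  rw [hb] at hc
  simpa using hc

/-- Subspaces of the terms of an independent family which together span everything
are equal to these terms. -/
theorem eq_of_iSupIndep_of_le_of_iSup_eq_top
    {R M ι : Type*} [Ring R] [AddCommGroup M] [Module R M] {p q : ι → Submodule R M}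
    (hp : iSupIndep p) (hle : ∀ i, q i ≤ p i) (htop : ⨆ i, q i = ⊤) (i : ι) : q i = p i := by
  refine le_antisymm (hle i) ?_
  have hdisj : (⨆ j, ⨆ (_ : j ≠ i), q j) ⊓ p i = ⊥ := by
    rw [inf_comm]
    exact ((hp i).mono_right (iSup₂_mono fun j _ => hle j)).eq_bot
  have hsup : q i ⊔ (⨆ j, ⨆ (_ : j ≠ i), q j) = ⊤ := by
    rw [eq_top_iff, ← htop]
    refine iSup_le fun j => ?_
    by_cases h : j = i
    · exact h ▸ le_sup_left
    · exact (le_iSup₂ (f := fun j (_ : j ≠ i) => q j) j h).trans le_sup_right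
  calc p i = (q i ⊔ (⨆ j, ⨆ (_ : j ≠ i), q j)) ⊓ p i := by rw [hsup, top_inf_eq]
    _ = q i := by rw [sup_inf_assoc_of_le _ (hle i), hdisj, sup_bot_eq]
    _ ≤ q i := le_rfl

theorem automorphism_fixing_zero_component_is_scalar
    (F : Type*) [Field F] [IsAlgClosed F] [CharZero F]
    (L : Type*) [LieRing L] [LieAlgebra F L] [FiniteDimensional F L]
    [LieAlgebra.IsSimple F L]
    (n : ℕ) (hn : 1 ≤ n)
    (gr : ZMod n → Submodule F L) (hgr : IsLieGrading F gr)
    -- `g₁` generates `L` as a Lie algebra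
    (hgen : LieSubalgebra.lieSpan F L (gr 1 : Set L) = ⊤)
    -- `g₁` is a nonzero irreducible `g₀`-module under the adjoint action
    (hne : gr 1 ≠ ⊥)
    (hirr : ∀ W : Submodule F L, W ≤ gr 1 →
      (∀ x ∈ gr 0, ∀ w ∈ W, ⁅x, w⁆ ∈ W) → W = ⊥ ∨ W = gr 1)
    (σ : L ≃ₗ⁅F⁆ L)
    -- `σ` preserves each homogeneous component
    (hpres : ∀ i : ZMod n, (gr i).map σ.toLinearEquiv.toLinearMap = gr i)
    -- `σ` fixes `g₀` pointwise
    (hfix : ∀ x ∈ gr 0, σ x = x) :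
    ∃ lam : F, lam ^ n = 1 ∧ ∀ i : ZMod n, ∀ x ∈ gr i, σ x = lam ^ i.val • x := by
  obtain ⟨hint, hbr⟩ := hgr
  have hmap : ∀ i, ∀ x ∈ gr i, σ x ∈ gr i := fun i x hx => by
    rw [← hpres i]
    exact ⟨x, hx, rfl⟩
  obtain ⟨lam, hlam⟩ : ∃ lam : F, ∀ x ∈ gr 1, σ x = lam • x := by
    have : Nontrivial (gr 1) := Submodule.nontrivial_iff_ne_bot.mpr hne
    let T : End F (gr 1) := σ.toLinearEquiv.toLinearMap.restrict (hmap 1)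
    obtain ⟨lam, hl⟩ := End.exists_eigenvalue T
    obtain ⟨v, hv⟩ := hl.exists_hasEigenvector
    refine ⟨lam, ?_⟩
    have hW := hirr (gr 1 ⊓ End.eigenspace σ.toLinearEquiv.toLinearMap lam) inf_le_left ?_
    · rcases hW with hW | hW
      · refine absurd ?_ hv.2
        have hvW : (v : L) ∈ gr 1 ⊓ End.eigenspace σ.toLinearEquiv.toLinearMap lam :=
          ⟨v.2, End.mem_eigenspace_iff.mpr (congrArg Subtype.val hv.apply_eq_smul)⟩
        rw [hW] at hvW
        exact Subtype.ext (by simpa using hvW)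
      · intro x hx
        rw [← hW] at hx
        exact End.mem_eigenspace_iff.mp hx.2
    · rintro x hx w ⟨hw, hwe⟩
      refine ⟨by simpa using hbr 0 1 x hx w hw, End.mem_eigenspace_iff.mpr ?_⟩
      have hwe' : σ w = lam • w := End.mem_eigenspace_iff.mp hwe
      change σ ⁅x, w⁆ = lam • ⁅x, w⁆
      rw [LieEquiv.map_lie, hfix x hx, hwe', lie_smul]
  have hpow : lam ^ n = 1 := by
    by_contra hln
    have hvanish : ∀ k ≤ n, ∀ z ∈ gr (k : ZMod n), σ z = lam ^ k • z → z = 0 := by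
      intro k hk
      induction hk using Nat.decreasingInduction with
      | self =>
        intro z hz hσ
        rw [ZMod.natCast_self] at hz
        rw [hfix z hz] at hσ
        have h0 : (lam ^ n - 1) • z = 0 := by rw [sub_smul, ← hσ, one_smul, sub_self]
        exact (smul_eq_zero.mp h0).resolve_left (sub_ne_zero.mpr hln)
      | of_succ k _ ih =>
        intro z hz hσ
        refine eq_zero_of_lieSpan_eq_top_of_forall_lie_eq_zero hgen fun x hx => ih _ ?_ ?_
        · rw [Nat.cast_succ, add_comm]
          exact hbr _ _ x hx z hz
        · rw [LieEquiv.map_lie, hlam x hx, hσ, smul_lie, lie_smul, smul_smul, pow_succ']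
    refine hne ((Submodule.eq_bot_iff _).mpr fun x hx => hvanish 1 hn x ?_ ?_)
    · simpa using hx
    · simpa using hlam x hx
  refine ⟨lam, hpow, ?_⟩
  have hval : ∀ k : ℕ, lam ^ (k : ZMod n).val = lam ^ k := fun k => by
    rw [ZMod.val_natCast, ← pow_eq_pow_mod k hpow]
  have : NeZero n := ⟨by omega⟩
  have hadd : ∀ i j : ZMod n, lam ^ (i + j).val = lam ^ i.val * lam ^ j.val := fun i j => by
    rw [ZMod.val_add, ← pow_eq_pow_mod _ hpow, pow_add]
  let q : ZMod n → Submodule F L := fun i =>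
    gr i ⊓ End.eigenspace σ.toLinearEquiv.toLinearMap (lam ^ i.val)
  have hq : ∀ i j, ∀ x ∈ q i, ∀ y ∈ q j, ⁅x, y⁆ ∈ q (i + j) := by
    rintro i j x ⟨hx, hxe⟩ y ⟨hy, hye⟩
    refine ⟨hbr i j x hx y hy, End.mem_eigenspace_iff.mpr ?_⟩
    have hxe' : σ x = lam ^ i.val • x := End.mem_eigenspace_iff.mp hxe
    have hye' : σ y = lam ^ j.val • y := End.mem_eigenspace_iff.mp hye
    change σ ⁅x, y⁆ = _
    rw [LieEquiv.map_lie, hxe', hye', smul_lie, lie_smul, smul_smul, hadd]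
  have hlie : ∀ x ∈ ⨆ i, q i, ∀ y ∈ ⨆ i, q i, ⁅x, y⁆ ∈ ⨆ i, q i := by
    intro x hx y hy
    induction hx using Submodule.iSup_induction' with
    | zero => simp
    | add x₁ x₂ _ _ h₁ h₂ => rw [add_lie]; exact add_mem h₁ h₂
    | mem i x hx =>
      induction hy using Submodule.iSup_induction' with
      | zero => simp
      | add y₁ y₂ _ _ h₁ h₂ => rw [lie_add]; exact add_mem h₁ h₂
      | mem j y hy => exact Submodule.mem_iSup_of_mem (i + j) (hq i j x hx y hy)
  let S : LieSubalgebra F L := { (⨆ i, q i) with lie_mem' := fun hx hy => hlie _ hx _ hy }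
  have hS : S = ⊤ := by
    rw [eq_top_iff, ← hgen, LieSubalgebra.lieSpan_le]
    intro x hx
    refine Submodule.mem_iSup_of_mem (p := q) 1 ⟨hx, End.mem_eigenspace_iff.mpr ?_⟩
    have h1 := hval 1
    rw [Nat.cast_one, pow_one] at h1
    rw [h1]
    exact hlam x hx
  have htop : ⨆ i, q i = ⊤ := congrArg LieSubalgebra.toSubmodule hS
  intro i x hx
  rw [← eq_of_iSupIndep_of_le_of_iSup_eq_top hint.submodule_iSupIndep
    (fun _ => inf_le_left) htop i] at hx
  exact End.mem_eigenspace_iff.mp hx.2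
end
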